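/- Let Λ be a generic interlacing sequence with concave corner set 𝕏 and let u_0 be a real number. For j ≥ 1 define K'_j = (j − 1)! · Σ_{T} Σ_{x} (−1)^{|B_T| − 1} f_T(x_1, ..., x_j) · ∏_{v=1}^{j} μ_Λ(x_v), where T ranges over non-crossing alternating trees on {1, ..., j}, and x ranges over maps {1, ..., j} → 𝕏 such that x_v ≤ u_0 for every black vertex v of T and x_v > u_0 for every white vertex v of T. Then for every n ≥ 1, M_n(Λ, u_0) = Σ_{π} ∏_{b ∈ π} K'_{|b|}, where π ranges over all set partitions of {1, ..., n} and b over the blocks of π. Equivalently, the numbers K'_n are the formal cumulants of the moment sequence (M_n(Λ, u_0))_{n ≥ 1}. -/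

import Mathlib

open Finset

open scoped Classical

/-- `(x_0, ..., x_L; y_1, ..., y_L)` is an interlacing sequence:
`x_0 < y_1 < x_1 < ... < y_L < x_L`. -/
def IsInterlacing (L : ℕ) (X : Fin (L + 1) → ℝ) (Y : Fin L → ℝ) : Prop :=
  ∀ k : Fin L, X k.castSucc < Y k ∧ Y k < X k.succ

/-- The interlacing sequence is generic: no difference of two distinct concave
corners is an integer. -/
def IsGeneric (L : ℕ) (X : Fin (L + 1) → ℝ) : Prop :=
  ∀ i j : Fin (L + 1), i ≠ j → ∀ m : ℤ, X i - X j ≠ (m : ℝ)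

/-- The Cauchy transform `G_Λ(z) = ∏ (z - y_k) / ∏ (z - x_k)`. -/
noncomputable def cauchyG (L : ℕ) (X : Fin (L + 1) → ℝ) (Y : Fin L → ℝ) (z : ℝ) : ℝ :=
  (∏ k, (z - Y k)) / (∏ k, (z - X k))

/-- The transition measure weight
`μ_Λ(x_i) = ∏_k (x_i - y_k) / ∏_{k ≠ i} (x_i - x_k)`. -/
noncomputable def muWeight (L : ℕ) (X : Fin (L + 1) → ℝ) (Y : Fin L → ℝ)
    (i : Fin (L + 1)) : ℝ :=
  (∏ k, (X i - Y k)) / (∏ k ∈ univ.erase i, (X i - X k))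

/-- The falling product `G_Λ^⟨k⟩(z) = G_Λ(z) G_Λ(z-1) ⋯ G_Λ(z-k+1)`. -/
noncomputable def cauchyGFall (L : ℕ) (X : Fin (L + 1) → ℝ) (Y : Fin L → ℝ)
    (k : ℕ) (z : ℝ) : ℝ :=
  ∏ t ∈ Finset.range k, cauchyG L X Y (z - t)

/-- `Θ(x_1, ..., x_ℓ)` with parameters `a_1, ..., a_ℓ`. -/
noncomputable def Theta (ℓ : ℕ) (a x : Fin ℓ → ℝ) : ℝ :=
  ∏ i : Fin ℓ, ∏ j ∈ univ.filter (fun j => i < j),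
    ((x i - x j) * (x i - x j - a i + a j)) /
      ((x i - x j + a j) * (x i - x j - a i))

/-- The tuples `x_1 > x_2 > ... > x_ℓ` of concave corners with `x_1 ≤ u_0`,
encoded by tuples of indices. -/
noncomputable def decTuples (L : ℕ) (X : Fin (L + 1) → ℝ) (u₀ : ℝ) (ℓ : ℕ) :
    Finset (Fin ℓ → Fin (L + 1)) :=
  univ.filter (fun r =>
    (∀ i j : Fin ℓ, i < j → X (r j) < X (r i)) ∧ (∀ i, X (r i) ≤ u₀))

/-- The `n`-th moment `M_n(Λ, u_0)` of a generic interlacing sequence. -/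
noncomputable def momentM (L : ℕ) (X : Fin (L + 1) → ℝ) (Y : Fin L → ℝ)
    (u₀ : ℝ) (n : ℕ) : ℝ :=
  (n.factorial : ℝ) *
    ∑ c : Composition n, ∑ r ∈ decTuples L X u₀ c.length,
      Theta c.length (fun i => (c.blocksFun i : ℝ)) (fun i => X (r i)) *
        ∏ i, ((-1 : ℝ) ^ (c.blocksFun i - 1) / (c.blocksFun i : ℝ)) *
          muWeight L X Y (r i) *
          cauchyGFall L X Y (c.blocksFun i - 1) (X (r i) - 1)

/-- `E` is the edge set of a non-crossing alternating tree on the `j` vertices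
`Fin j` (written with edges `(i, m)`, `i < m`): there are `j - 1` edges and the
graph is connected (hence a tree); no two edges `{i, m}` and `{k, l}` satisfy
`i < k < m < l` (non-crossing); and no vertex has both an incoming and an
outgoing edge, i.e. every vertex is either smaller than all of its neighbours or
larger than all of its neighbours (alternating). -/
def IsNCATree (j : ℕ) (E : Finset (Fin j × Fin j)) : Prop :=
  (∀ e ∈ E, e.1 < e.2) ∧
  E.card = j - 1 ∧
  (∀ v w : Fin j,
    Relation.ReflTransGen (fun a b => (a, b) ∈ E ∨ (b, a) ∈ E) v w) ∧
  (∀ e ∈ E, ∀ e' ∈ E, ¬ (e.1 < e'.1 ∧ e'.1 < e.2 ∧ e.2 < e'.2)) ∧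
  (∀ i v m : Fin j, (i, v) ∈ E → (v, m) ∈ E → False)

/-- The black vertices of a non-crossing alternating tree: the vertices which are
smaller than all of their neighbours (no incoming edge); for `j = 1` the unique
vertex is black.  The remaining vertices are white. -/
noncomputable def blackSet (j : ℕ) (E : Finset (Fin j × Fin j)) : Finset (Fin j) :=
  univ.filter (fun v => ∀ i, (i, v) ∉ E)

/-- The quantity `K'_j`: a sum over non-crossing alternating trees `T` with `j`
vertices and over the maps `r` from the vertices to the concave corners which take
values `≤ u₀` on the black vertices of `T` and values `> u₀` on its white
vertices, of `(-1)^{|B_T| - 1} f_T ⬝ ∏_v μ_Λ(x_v)`. -/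
noncomputable def Kprime (L : ℕ) (X : Fin (L + 1) → ℝ) (Y : Fin L → ℝ)
    (u₀ : ℝ) (j : ℕ) : ℝ :=
  ((j - 1).factorial : ℝ) *
    ∑ E ∈ (univ : Finset (Finset (Fin j × Fin j))).filter (IsNCATree j),
      ∑ r ∈ (univ : Finset (Fin j → Fin (L + 1))).filter
          (fun r => (∀ v ∈ blackSet j E, X (r v) ≤ u₀) ∧
            (∀ v, v ∉ blackSet j E → u₀ < X (r v))),
        (-1 : ℝ) ^ ((blackSet j E).card - 1) *
          (∏ e ∈ E,
            1 / (X (r e.2) - X (r e.1) + (((e.2 : ℕ) : ℝ) - ((e.1 : ℕ) : ℝ)))) *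
          ∏ v, muWeight L X Y (r v)

/-- `π` is a set partition of `Fin n`: its blocks are nonempty and every element
belongs to exactly one block. -/
def IsSetPartition (n : ℕ) (π : Finset (Finset (Fin n))) : Prop :=
  ∅ ∉ π ∧ ∀ v : Fin n, ∃! b, b ∈ π ∧ v ∈ b


theorem IsInterlacing.strictMono {L : ℕ} {X : Fin (L + 1) → ℝ} {Y : Fin L → ℝ}
    (h : IsInterlacing L X Y) : StrictMono X :=
  Fin.strictMono_iff_lt_succ.2 fun k => (h k).1.trans (h k).2

/-- Partial fraction expansion of the Cauchy transform. -/
theorem cauchyG_eq_sum {L : ℕ} {X : Fin (L + 1) → ℝ} (hX : Function.Injective X)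
    (Y : Fin L → ℝ) {z : ℝ} (hz : ∀ i, z ≠ X i) :
    cauchyG L X Y z = ∑ i, muWeight L X Y i / (z - X i) := by
  set P : Polynomial ℝ := ∏ k, (Polynomial.X - Polynomial.C (Y k)) with hP
  have hdeg : P.degree < (univ : Finset (Fin (L + 1))).card := by
    rw [hP, Polynomial.degree_prod]
    simp only [Polynomial.degree_X_sub_C, sum_const, card_univ, Fintype.card_fin, nsmul_eq_mul,
      mul_one]
    exact_mod_cast Nat.lt_succ_self L
  have heval : ∀ w, P.eval w = ∏ k, (w - Y k) := fun w => by
    simp [hP, Polynomial.eval_prod]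
  have h1 := Lagrange.eq_interpolate_of_eval_eq (s := univ) (v := X) (f := P)
    (r := fun i => ∏ k, (X i - Y k)) hX.injOn hdeg (fun i _ => heval _)
  have h2 := Lagrange.eval_interpolate_not_at_node (s := univ) (v := X)
    (r := fun i => ∏ k, (X i - Y k)) (x := z) (fun i _ => hz i)
  rw [← h1, heval, Lagrange.eval_nodal] at h2
  rw [cauchyG, h2, mul_div_cancel_left₀ _ (prod_ne_zero_iff.2 fun i _ => sub_ne_zero.2 (hz i))]
  refine sum_congr rfl fun i _ => ?_
  rw [muWeight, Lagrange.nodalWeight, prod_inv_distrib]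
  ring

theorem IsGeneric.add_ne_zero {L : ℕ} {X : Fin (L + 1) → ℝ} (h : IsGeneric L X)
    (i j : Fin (L + 1)) {b : ℕ} (hb : b ≠ 0) : X i - X j + b ≠ 0 := by
  by_cases hij : i = j
  · simpa [hij] using hb
  · intro h0
    refine h i j hij (-b) ?_
    push_cast
    linarith

/-- The Cauchy determinant. -/
theorem det_cauchy {n : ℕ} (x y : Fin n → ℝ) (h : ∀ i j, x i - y j ≠ 0) :
    (Matrix.of fun i j => 1 / (x i - y j)).det =
      (∏ i : Fin n, ∏ j ∈ univ.filter (fun j => i < j),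
        ((x i - x j) * (y j - y i)) / ((x i - y j) * (x j - y i))) * ∏ i, 1 / (x i - y i) := by
  induction n with
  | zero => simp
  | succ n ih =>
    set B : Matrix (Fin (n + 1)) (Fin (n + 1)) ℝ := Matrix.of fun i j =>
      if i = 0 then 1 / (x 0 - y j)
      else 1 / (x i - y j) - (x 0 - y 0) / (x i - y 0) * (1 / (x 0 - y j)) with hB
    have h1 : (Matrix.of fun i j => 1 / (x i - y j)).det = B.det := by
      refine Matrix.det_eq_of_forall_row_eq_smul_add_const
        (fun i => if i = 0 then 0 else (x 0 - y 0) / (x i - y 0)) 0 (by simp) fun i j => ?_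
      by_cases hi : i = 0 <;> simp [hB, hi]
    have h2 : B.submatrix (Fin.succAbove 0) Fin.succ =
        Matrix.of fun i j => ((x 0 - x i.succ) / (x i.succ - y 0)) *
          (Matrix.of (fun i j => ((y j.succ - y 0) / (x 0 - y j.succ)) *
            (Matrix.of fun i j : Fin n => 1 / (x i.succ - y j.succ)) i j)) i j := by
      ext i j
      simp only [hB, Matrix.submatrix_apply, Matrix.of_apply, Fin.succAbove_zero,
        Fin.succ_ne_zero, if_false]
      have e1 := h i.succ j.succ
      have e2 := h i.succ 0
      have e3 := h 0 j.succ
      field_simp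
      ring
    rw [h1, Matrix.det_succ_column_zero, Finset.sum_eq_single 0]
    · rw [h2, Matrix.det_mul_column, Matrix.det_mul_row, ih _ _ fun i j => h i.succ j.succ]
      simp only [prod_filter, Fin.prod_univ_succ, Fin.succ_lt_succ_iff, Fin.succ_pos, if_true,
        Fin.not_lt_zero, if_false, one_mul]
      simp only [hB, Matrix.of_apply, if_true, Fin.val_zero, pow_zero, one_mul]
      have : (∏ i : Fin n, (x 0 - x i.succ) / (x i.succ - y 0)) *
          ∏ i : Fin n, (y i.succ - y 0) / (x 0 - y i.succ) =
          ∏ i : Fin n, (x 0 - x i.succ) * (y i.succ - y 0) /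
            ((x 0 - y i.succ) * (x i.succ - y 0)) := by
        rw [← prod_mul_distrib]
        refine prod_congr rfl fun i _ => ?_
        rw [div_mul_div_comm, mul_comm (x i.succ - y 0)]
      rw [← this]
      ring
    · intro i _ hi
      have e2 := h i 0
      have e3 := h 0 0
      have : B i 0 = 0 := by
        simp only [hB, Matrix.of_apply, hi, if_false]
        field_simp
        ring
      simp [this]
    · simp

/-- Expansion of `det (1 + K)` into principal minors. -/
theorem det_one_add_eq_sum_minors {n R : Type*} [Fintype n] [DecidableEq n] [CommRing R]
    (M : Matrix n n R) :
    (1 + M).det = ∑ s : Finset n, (M.submatrix (Subtype.val : s → n) (Subtype.val : s → n)).det := by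
  have h := (Matrix.detRowAlternating (R := R) (n := n)).toMultilinearMap.map_add_univ
    M.row (1 : Matrix n n R).row
  rw [add_comm]
  refine Eq.trans h (sum_congr rfl fun s _ => ?_)
  exact Matrix.det_piecewise_one_eq_submatrix_det M s

/-- Jacobi's formula for a derivation. -/
theorem Derivation.map_det {n R A : Type*} [Fintype n] [DecidableEq n] [CommRing R] [CommRing A]
    [Algebra R A] (D : Derivation R A A) (M : Matrix n n A) :
    D M.det = (M.adjugate * M.map D).trace := by
  have hprod : ∀ (s : Finset n) (f : n → A),
      D (∏ i ∈ s, f i) = ∑ i ∈ s, D (f i) * ∏ j ∈ s.erase i, f j := by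
    intro s f
    induction s using Finset.induction_on with
    | empty => simp
    | insert a s ha ih =>
      rw [prod_insert ha, D.leibniz, ih, sum_insert ha, erase_insert ha, smul_eq_mul, smul_eq_mul,
        mul_sum, add_comm, mul_comm]
      congr 1
      refine sum_congr rfl fun i hi => ?_
      have : a ≠ i := fun h => ha (h ▸ hi)
      rw [erase_insert_of_ne this, prod_insert (fun h => ha (mem_of_mem_erase h))]
      ring
  have key : D M.det = ∑ i, (M.updateCol i (fun k => D (M k i))).det := by
    rw [Matrix.det_apply, map_sum]
    simp_rw [Matrix.det_apply]
    rw [sum_comm]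
    refine sum_congr rfl fun σ _ => ?_
    rw [Units.smul_def, map_zsmul, hprod, ← Units.smul_def, smul_sum]
    refine sum_congr rfl fun i _ => ?_
    rw [← mul_prod_erase univ _ (mem_univ i)]
    congr 1
    congr 1
    · simp
    · refine prod_congr rfl fun j hj => ?_
      rw [Matrix.updateCol_ne (ne_of_mem_erase hj)]
  rw [key, Matrix.trace]
  refine sum_congr rfl fun i _ => ?_
  rw [← Matrix.cramer_apply, Matrix.cramer_eq_adjugate_mulVec]
  rfl

/-- `π` is a partition of the finset `s` into nonempty blocks. -/
def IsFinsetPartition {α : Type*} (s : Finset α) (π : Finset (Finset α)) : Prop :=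
  ∅ ∉ π ∧ (∀ b ∈ π, b ⊆ s) ∧ ∀ v ∈ s, ∃! b, b ∈ π ∧ v ∈ b

/-- The finset of partitions of `s`. -/
noncomputable def finsetPartitions {α : Type*} (s : Finset α) : Finset (Finset (Finset α)) :=
  s.powerset.powerset.filter (IsFinsetPartition s)

theorem mem_finsetPartitions {α : Type*} {s : Finset α} {π : Finset (Finset α)} :
    π ∈ finsetPartitions s ↔ IsFinsetPartition s π := by
  rw [finsetPartitions, mem_filter, and_iff_right_iff_imp]
  intro h
  exact mem_powerset.2 fun b hb => mem_powerset.2 (h.2.1 b hb)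

/-- Adding to a partition of `s \ t` the block `insert a t`. -/
theorem IsFinsetPartition.insert {α : Type*} {s t : Finset α} {a : α} {π : Finset (Finset α)}
    (ha : a ∉ s) (ht : t ⊆ s) (h : IsFinsetPartition (s \ t) π) :
    IsFinsetPartition (insert a s) (insert (insert a t) π) := by
  obtain ⟨h0, h1, h2⟩ := h
  have hna : ∀ b ∈ π, a ∉ b := fun b hb hab => ha (mem_sdiff.1 (h1 b hb hab)).1
  have hnt : ∀ v ∈ t, ∀ b ∈ π, v ∉ b := fun v hv b hb hab => (mem_sdiff.1 (h1 b hb hab)).2 hv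
  refine ⟨?_, ?_, ?_⟩
  · simp only [mem_insert, not_or]
    exact ⟨(insert_ne_empty a t).symm, h0⟩
  · intro b hb
    rcases mem_insert.1 hb with rfl | hb
    · exact insert_subset_insert a ht
    · exact (h1 b hb).trans (sdiff_subset.trans (subset_insert a s))
  · intro v hv
    by_cases hvt : v ∈ Insert.insert a t
    · refine ⟨Insert.insert a t, ⟨mem_insert_self _ _, hvt⟩, ?_⟩
      rintro b ⟨hb, hvb⟩
      rcases mem_insert.1 hb with h | h
      · exact h
      · rcases mem_insert.1 hvt with h' | h'
        · exact absurd (h' ▸ hvb) (hna b h)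
        · exact absurd hvb (hnt v h' b h)
    · have hvs : v ∈ s \ t := by
        simp only [mem_insert, not_or, mem_sdiff] at hvt hv ⊢
        tauto
      obtain ⟨b, ⟨hb, hvb⟩, hu⟩ := h2 v hvs
      refine ⟨b, ⟨mem_insert_of_mem hb, hvb⟩, ?_⟩
      rintro b' ⟨hb', hvb'⟩
      rcases mem_insert.1 hb' with rfl | hb'
      · exact absurd hvb' hvt
      · exact hu b' ⟨hb', hvb'⟩

/-- Removing the block of `a` from a partition of `insert a s`. -/
theorem IsFinsetPartition.exists_insert {α : Type*} {s : Finset α} {a : α}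
    {π : Finset (Finset α)} (ha : a ∉ s) (h : IsFinsetPartition (Insert.insert a s) π) :
    ∃ t ⊆ s, ∃ ρ, IsFinsetPartition (s \ t) ρ ∧ Insert.insert (Insert.insert a t) ρ = π := by
  obtain ⟨h0, h1, h2⟩ := h
  obtain ⟨b, ⟨hb, hab⟩, hu⟩ := h2 a (mem_insert_self _ _)
  have hins : Insert.insert a (b.erase a) = b := insert_erase hab
  have hdisj : ∀ b' ∈ π.erase b, ∀ v ∈ b', v ∉ b := by
    intro b' hb' v hv hvb
    obtain ⟨c, -, hc⟩ := h2 v (h1 b hb hvb)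
    exact ne_of_mem_erase hb' ((hc b' ⟨mem_of_mem_erase hb', hv⟩).trans (hc b ⟨hb, hvb⟩).symm)
  refine ⟨b.erase a, ?_, π.erase b, ⟨?_, ?_, ?_⟩, ?_⟩
  · intro v hv
    exact (mem_insert.1 (h1 b hb (mem_of_mem_erase hv))).resolve_left (ne_of_mem_erase hv)
  · exact fun h => h0 (mem_of_mem_erase h)
  · intro b' hb' v hv
    have hvb := hdisj b' hb' v hv
    have := mem_insert.1 (h1 b' (mem_of_mem_erase hb') hv)
    refine mem_sdiff.2 ⟨this.resolve_left fun h => hvb (h ▸ hab), fun h => hvb (mem_of_mem_erase h)⟩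
  · intro v hv
    obtain ⟨hvs, hvb⟩ := mem_sdiff.1 hv
    have hvb' : v ∉ b := fun h => hvb (mem_erase.2 ⟨fun h' => ha (h' ▸ hvs), h⟩)
    obtain ⟨c, ⟨hc, hvc⟩, hu'⟩ := h2 v (mem_insert_of_mem hvs)
    refine ⟨c, ⟨mem_erase.2 ⟨fun h => hvb' (h ▸ hvc), hc⟩, hvc⟩, ?_⟩
    rintro c' ⟨hc', hvc'⟩
    exact hu' c' ⟨mem_of_mem_erase hc', hvc'⟩
  · rw [hins, insert_erase hb]

theorem sum_finsetPartitions_insert {α : Type*} {s : Finset α} {a : α} (ha : a ∉ s)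
    (f : Finset α → ℝ) :
    ∑ π ∈ finsetPartitions (insert a s), ∏ b ∈ π, f b =
      ∑ t ∈ s.powerset, f (insert a t) * ∑ π ∈ finsetPartitions (s \ t), ∏ b ∈ π, f b := by
  simp_rw [mul_sum]
  rw [sum_sigma']
  symm
  have hmem : ∀ x : (_ : Finset α) × Finset (Finset α),
      x ∈ (s.powerset.sigma fun t => finsetPartitions (s \ t)) →
      x.1 ⊆ s ∧ IsFinsetPartition (s \ x.1) x.2 := fun x hx => by
    rw [mem_sigma, mem_powerset, mem_finsetPartitions] at hx
    exact hx
  have hnot : ∀ (t : Finset α) (π : Finset (Finset α)), IsFinsetPartition (s \ t) π →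
      ∀ b ∈ π, a ∉ b := fun t π h b hb hab => ha (mem_sdiff.1 (h.2.1 b hb hab)).1
  refine sum_bij (fun x _ => insert (insert a x.1) x.2) ?_ ?_ ?_ ?_
  · intro x hx
    obtain ⟨h1, h2⟩ := hmem x hx
    exact mem_finsetPartitions.2 (h2.insert ha h1)
  · rintro ⟨t, π⟩ hx ⟨t', π'⟩ hx' heq
    obtain ⟨h1, h2⟩ := hmem _ hx
    obtain ⟨h1', h2'⟩ := hmem _ hx'
    dsimp only at h1 h2 h1' h2' heq
    have hat : a ∉ t := fun h => ha (h1 h)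
    have hat' : a ∉ t' := fun h => ha (h1' h)
    have e1 : insert a t = insert a t' := by
      have : insert a t ∈ insert (insert a t') π' := heq ▸ mem_insert_self _ _
      rcases mem_insert.1 this with h | h
      · exact h
      · exact absurd (mem_insert_self a t) (hnot _ _ h2' _ h)
    have e2 : t = t' := by rw [← erase_insert hat, e1, erase_insert hat']
    subst e2
    have n1 : insert a t ∉ π := fun h => hnot _ _ h2 _ h (mem_insert_self a t)
    have n2 : insert a t ∉ π' := fun h => hnot _ _ h2' _ h (mem_insert_self a t)
    have e3 : π = π' := by rw [← erase_insert n1, heq, erase_insert n2]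
    subst e3
    rfl
  · intro π hπ
    obtain ⟨t, ht, ρ, hρ, rfl⟩ := (mem_finsetPartitions.1 hπ).exists_insert ha
    exact ⟨⟨t, ρ⟩, by
      rw [mem_sigma, mem_powerset, mem_finsetPartitions]; exact ⟨ht, hρ⟩, rfl⟩
  · intro x hx
    obtain ⟨h1, h2⟩ := hmem x hx
    rw [prod_insert fun h => hnot _ _ h2 _ h (mem_insert_self a x.1)]

/-- A sequence satisfying the moment-cumulant recursion is the sum over set partitions. -/
theorem sum_finsetPartitions_eq {α : Type*} (κ m : ℕ → ℝ) (h0 : m 0 = 1)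
    (hm : ∀ n, m (n + 1) = ∑ k ∈ range (n + 1), (n.choose k : ℝ) * (κ (k + 1) * m (n - k)))
    (s : Finset α) :
    ∑ π ∈ finsetPartitions s, ∏ b ∈ π, κ b.card = m s.card := by
  induction s using Finset.strongInduction with
  | H s ih =>
    rcases s.eq_empty_or_nonempty with rfl | ⟨a, ha⟩
    · have : finsetPartitions (∅ : Finset α) = {∅} := by
        ext π
        rw [mem_finsetPartitions, mem_singleton]
        constructor
        · rintro ⟨h0, h1, -⟩
          refine eq_empty_of_forall_notMem fun b hb => h0 ?_
          rwa [← subset_empty.1 (h1 b hb)]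
        · rintro rfl
          exact ⟨by simp, by simp, by simp⟩
      simp [this, h0]
    · obtain ⟨s, has, rfl⟩ : ∃ t, a ∉ t ∧ insert a t = s :=
        ⟨s.erase a, notMem_erase a s, insert_erase ha⟩
      rw [sum_finsetPartitions_insert has (fun b => κ b.card), card_insert_of_notMem has, hm]
      have : ∀ t ∈ s.powerset, κ (insert a t).card *
          ∑ π ∈ finsetPartitions (s \ t), ∏ b ∈ π, κ b.card =
          κ (t.card + 1) * m (s.card - t.card) := by
        intro t ht
        rw [mem_powerset] at ht
        rw [ih, card_insert_of_notMem fun h => has (ht h), card_sdiff_of_subset ht]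
        exact ⟨sdiff_subset.trans (subset_insert a s),
          fun h => has (mem_sdiff.1 (h (mem_insert_self a s))).1⟩
      rw [sum_congr rfl this, sum_powerset_apply_card (fun k => κ (k + 1) * m (s.card - k))]
      simp [nsmul_eq_mul]

theorem filter_isSetPartition (n : ℕ) :
    (univ : Finset (Finset (Finset (Fin n)))).filter (IsSetPartition n) =
      finsetPartitions univ := by
  ext π
  rw [mem_finsetPartitions, mem_filter]
  simp [IsSetPartition, IsFinsetPartition]

/-- The weight `(-1)^(b-1) μ_Λ(x) G_Λ^⟨b-1⟩(x-1)`, extended by `0` to `b = 0`. -/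
noncomputable def stepWeight (L : ℕ) (X : Fin (L + 1) → ℝ) (Y : Fin L → ℝ)
    (i : Fin (L + 1)) : ℕ → ℝ
  | 0 => 0
  | b + 1 => (-1) ^ b * muWeight L X Y i * cauchyGFall L X Y b (X i - 1)

/-- The kernel whose Fredholm determinant generates the moments. -/
noncomputable def momentKernel (L : ℕ) (X : Fin (L + 1) → ℝ) (Y : Fin L → ℝ)
    (y x : Fin (L + 1)) : PowerSeries ℝ :=
  PowerSeries.mk fun b => stepWeight L X Y x b / (X y - X x + b)

/-- The kernel `momentKernel` restricted to the concave corners `≤ u₀`. -/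
noncomputable def lowKernel (L : ℕ) (X : Fin (L + 1) → ℝ) (Y : Fin L → ℝ) (u₀ : ℝ) :
    Matrix {i // X i ≤ u₀} {i // X i ≤ u₀} (PowerSeries ℝ) :=
  Matrix.of fun y x => momentKernel L X Y y x

theorem Theta_mul_prod_eq_det {L : ℕ} {X : Fin (L + 1) → ℝ} (hgen : IsGeneric L X)
    (Y : Fin L → ℝ) {ℓ : ℕ} (a : Fin ℓ → ℕ) (ha : ∀ i, 0 < a i) (r : Fin ℓ → Fin (L + 1)) :
    Theta ℓ (fun i => (a i : ℝ)) (fun i => X (r i)) *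
        ∏ i, ((-1 : ℝ) ^ (a i - 1) / (a i : ℝ)) * muWeight L X Y (r i) *
          cauchyGFall L X Y (a i - 1) (X (r i) - 1) =
      (Matrix.of fun i j => PowerSeries.coeff (a j) (momentKernel L X Y (r i) (r j))).det := by
  have h := det_cauchy (fun i => X (r i)) (fun j => X (r j) - a j) fun i j => by
    have := hgen.add_ne_zero (r i) (r j) (ha j).ne'
    rwa [← sub_add]
  have hw : (Matrix.of fun i j => PowerSeries.coeff (a j) (momentKernel L X Y (r i) (r j))) =
      Matrix.of fun i j => stepWeight L X Y (r j) (a j) *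
        (Matrix.of fun i j => 1 / (X (r i) - (X (r j) - a j))) i j := by
    ext i j
    simp [momentKernel, sub_add, div_eq_mul_inv]
  rw [hw, Matrix.det_mul_row, h, Theta]
  refine (congrArg₂ (· * ·) ?_ ?_).trans (mul_left_comm _ _ _)
  · refine prod_congr rfl fun i _ => prod_congr rfl fun j _ => ?_
    rw [← neg_div_neg_eq]
    congr 1 <;> ring
  · rw [← prod_mul_distrib]
    refine prod_congr rfl fun i _ => ?_
    obtain ⟨b, hb⟩ := Nat.exists_eq_succ_of_ne_zero (ha i).ne'
    rw [hb]
    simp only [stepWeight, Nat.succ_eq_add_one, Nat.add_sub_cancel, sub_sub_cancel]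
    ring

theorem coeff_det {n : Type*} [Fintype n] [DecidableEq n] (M : Matrix n n (PowerSeries ℝ))
    (d : ℕ) :
    PowerSeries.coeff d M.det = ∑ a ∈ finsuppAntidiag (univ : Finset n) d,
      (Matrix.of fun i j => PowerSeries.coeff (a j) (M i j)).det := by
  simp_rw [Matrix.det_apply]
  rw [map_sum, sum_comm]
  refine sum_congr rfl fun σ _ => ?_
  rw [← smul_sum, Units.smul_def, Units.smul_def, map_zsmul, PowerSeries.coeff_prod]
  simp

/-- Compositions of `n` as tuples of positive integers with sum `n`. -/
theorem sum_composition {n N : ℕ} (hN : n < N) (h : ∀ ℓ : ℕ, (Fin ℓ → ℕ) → ℝ) :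
    ∑ c : Composition n, h c.length c.blocksFun =
      ∑ ℓ ∈ range N, ∑ a ∈ (finsuppAntidiag (univ : Finset (Fin ℓ)) n).filter
        (fun a => ∀ i, 0 < a i), h ℓ a := by
  rw [sum_sigma']
  refine sum_bij (fun c _ => ⟨c.length, Finsupp.equivFunOnFinite.symm c.blocksFun⟩) ?_ ?_ ?_ ?_
  · intro c _
    rw [mem_sigma, mem_range, mem_filter, mem_finsuppAntidiag]
    refine ⟨c.length_le.trans_lt hN, ⟨?_, subset_univ _⟩, fun i => c.blocks_pos' _ _⟩
    exact c.sum_blocksFun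
  · intro c _ c' _ heq
    have h1 : (⟨c.length, c.blocksFun⟩ : Σ ℓ, Fin ℓ → ℕ) = ⟨c'.length, c'.blocksFun⟩ := by
      have := congrArg (fun x : Σ ℓ, Fin ℓ →₀ ℕ => (⟨x.1, x.2⟩ : Σ ℓ, Fin ℓ → ℕ)) heq
      simpa using this
    ext1
    rw [← c.ofFn_blocksFun, ← c'.ofFn_blocksFun]
    exact List.ofFn_inj'.2 h1
  · rintro ⟨ℓ, a⟩ ha
    rw [mem_sigma, mem_range, mem_filter, mem_finsuppAntidiag] at ha
    obtain ⟨-, ⟨hs, -⟩, hpos⟩ := ha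
    let c : Composition n := ⟨List.ofFn a, by
      intro i hi
      obtain ⟨j, rfl⟩ := (List.mem_ofFn' _ _).1 hi
      exact hpos j, by rw [List.sum_ofFn]; exact hs⟩
    refine ⟨c, mem_univ _, ?_⟩
    have h1 : (⟨c.length, c.blocksFun⟩ : Σ ℓ, Fin ℓ → ℕ) = ⟨ℓ, a⟩ :=
      List.ofFn_inj'.1 c.ofFn_blocksFun
    have := congrArg (fun x : Σ ℓ, Fin ℓ → ℕ =>
      (⟨x.1, Finsupp.equivFunOnFinite.symm x.2⟩ : Σ ℓ, Fin ℓ →₀ ℕ)) h1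
    simpa using this
  · intro c _
    rfl

theorem sum_minors_lowKernel {L : ℕ} {X : Fin (L + 1) → ℝ} (hX : StrictMono X)
    (Y : Fin L → ℝ) (u₀ : ℝ) {N : ℕ} (hN : L + 1 < N) :
    (1 + lowKernel L X Y u₀).det = ∑ ℓ ∈ range N, ∑ r ∈ decTuples L X u₀ ℓ,
      (Matrix.of fun i j => momentKernel L X Y (r i) (r j)).det := by
  rw [det_one_add_eq_sum_minors, sum_sigma']
  symm
  have hmem : ∀ x : (Σ ℓ, Fin ℓ → Fin (L + 1)),
      x ∈ (range N).sigma (fun ℓ => decTuples L X u₀ ℓ) →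
        StrictMono (x.2 ∘ Fin.rev) ∧ ∀ i, X (x.2 i) ≤ u₀ := by
    intro x hx
    rw [mem_sigma, decTuples, mem_filter] at hx
    refine ⟨fun i j hij => hX.lt_iff_lt.1 (hx.2.2.1 _ _ (Fin.rev_lt_rev.2 hij)), hx.2.2.2⟩
  have hinj : ∀ x : (Σ ℓ, Fin ℓ → Fin (L + 1)), StrictMono (x.2 ∘ Fin.rev) →
      Function.Injective x.2 := by
    intro x hx i j hij
    exact Fin.rev_injective (hx.injective (a₁ := Fin.rev i) (a₂ := Fin.rev j) (by simpa using hij))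
  refine sum_bij (fun x _ => univ.filter fun y : {i // X i ≤ u₀} => ∃ i, x.2 i = y)
    (fun _ _ => mem_univ _) ?_ ?_ ?_
  · intro x hx x' hx' heq
    obtain ⟨h1, h2⟩ := hmem x hx
    obtain ⟨h1', h2'⟩ := hmem x' hx'
    have hr : Set.range x.2 = Set.range x'.2 := by
      ext y
      constructor
      · rintro ⟨i, rfl⟩
        have : (⟨x.2 i, h2 i⟩ : {i // X i ≤ u₀}) ∈
          univ.filter fun y : {i // X i ≤ u₀} => ∃ i, x'.2 i = y := heq ▸ by simp
        simpa using this
      · rintro ⟨i, rfl⟩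
        have : (⟨x'.2 i, h2' i⟩ : {i // X i ≤ u₀}) ∈
          univ.filter fun y : {i // X i ≤ u₀} => ∃ i, x.2 i = y := heq ▸ by simp
        simpa using this
    obtain ⟨ℓ, r⟩ := x
    obtain ⟨ℓ', r'⟩ := x'
    dsimp only at *
    have hℓ : ℓ = ℓ' := by
      have e1 := Set.ncard_range_of_injective (hinj ⟨ℓ, r⟩ h1)
      have e2 := Set.ncard_range_of_injective (hinj ⟨ℓ', r'⟩ h1')
      dsimp only at e1 e2
      rw [hr, e2] at e1
      simpa using e1.symm
    subst hℓ
    have : r ∘ Fin.rev = r' ∘ Fin.rev := by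
      refine (StrictMono.range_inj h1 h1').1 ?_
      rw [Fin.rev_surjective.range_comp, Fin.rev_surjective.range_comp, hr]
    have : r = r' := Fin.rev_surjective.injective_comp_right this
    rw [this]
  · intro s _
    let s' : Finset (Fin (L + 1)) := s.map ⟨Subtype.val, Subtype.val_injective⟩
    have hrange : ∀ y, (∃ i, s'.orderEmbOfFin rfl (Fin.rev i) = y) ↔ y ∈ s' := by
      intro y
      have := congrArg (y ∈ ·) (s'.range_orderEmbOfFin rfl)
      simp only [Set.mem_range, eq_iff_iff, mem_coe] at this
      rw [← this]
      exact ⟨fun ⟨i, hi⟩ => ⟨_, hi⟩, fun ⟨i, hi⟩ => ⟨Fin.rev i, by simpa using hi⟩⟩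
    refine ⟨⟨s'.card, fun i => s'.orderEmbOfFin rfl (Fin.rev i)⟩, ?_, ?_⟩
    · rw [mem_sigma, mem_range, decTuples, mem_filter]
      refine ⟨lt_of_le_of_lt (by simpa using card_le_univ s') hN, mem_univ _, ?_, ?_⟩
      · intro i j hij
        exact hX ((s'.orderEmbOfFin rfl).strictMono (Fin.rev_lt_rev.2 hij))
      · intro i
        have := (hrange _).1 ⟨i, rfl⟩
        obtain ⟨y, -, hy⟩ := mem_map.1 this
        dsimp only at hy ⊢
        rw [← hy]
        exact y.2
    · ext y
      simp only [mem_filter, mem_univ, true_and, hrange]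
      simp [s']
  · intro x hx
    obtain ⟨h1, h2⟩ := hmem x hx
    let e : Fin x.1 ≃ (univ.filter fun y : {i // X i ≤ u₀} => ∃ i, x.2 i = y) :=
      Equiv.ofBijective (fun i => ⟨⟨x.2 i, h2 i⟩, by simp⟩) ⟨fun i j hij => hinj x h1 (by
        simpa using hij), by
          rintro ⟨y, hy⟩
          obtain ⟨i, hi⟩ := (mem_filter.1 hy).2
          exact ⟨i, Subtype.ext (Subtype.ext hi)⟩⟩
    rw [← Matrix.det_submatrix_equiv_self e]
    rfl

theorem momentM_eq_coeff {L : ℕ} {X : Fin (L + 1) → ℝ} (hX : StrictMono X)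
    (hgen : IsGeneric L X) (Y : Fin L → ℝ) (u₀ : ℝ) (n : ℕ) :
    momentM L X Y u₀ n =
      n.factorial * PowerSeries.coeff n (1 + lowKernel L X Y u₀).det := by
  rw [momentM]
  congr 1
  have hterm : ∀ c : Composition n,
      (∑ r ∈ decTuples L X u₀ c.length,
        Theta c.length (fun i => (c.blocksFun i : ℝ)) (fun i => X (r i)) *
        ∏ i, ((-1 : ℝ) ^ (c.blocksFun i - 1) / (c.blocksFun i : ℝ)) *
          muWeight L X Y (r i) *
          cauchyGFall L X Y (c.blocksFun i - 1) (X (r i) - 1)) =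
      (fun (ℓ : ℕ) (a : Fin ℓ → ℕ) => ∑ r ∈ decTuples L X u₀ ℓ,
        (Matrix.of fun i j => PowerSeries.coeff (a j) (momentKernel L X Y (r i) (r j))).det)
        c.length c.blocksFun := fun c =>
    sum_congr rfl fun r _ => Theta_mul_prod_eq_det hgen Y _ (fun i => c.blocks_pos' _ _) r
  rw [sum_congr rfl fun c _ => hterm c, sum_composition (N := n + L + 2) (by omega)
      (fun (ℓ : ℕ) (a : Fin ℓ → ℕ) => ∑ r ∈ decTuples L X u₀ ℓ,
        (Matrix.of fun i j => PowerSeries.coeff (a j) (momentKernel L X Y (r i) (r j))).det),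
    sum_minors_lowKernel hX Y u₀ (N := n + L + 2) (by omega), map_sum]
  refine sum_congr rfl fun ℓ _ => ?_
  rw [map_sum, sum_comm]
  refine sum_congr rfl fun r _ => ?_
  rw [coeff_det]
  refine sum_subset (filter_subset _ _) fun a ha hna => ?_
  obtain ⟨j, hj⟩ : ∃ j, a j = 0 := by
    by_contra! hcon
    exact hna (mem_filter.2 ⟨ha, fun i => Nat.pos_of_ne_zero (hcon i)⟩)
  refine Matrix.det_eq_zero_of_column_eq_zero j fun i => ?_
  simp [momentKernel, hj, stepWeight]

section Riccati

variable {S A : Type*} [Fintype S] [DecidableEq S] [CommRing A] [Algebra ℝ A]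
  (D : Derivation ℝ A A) (x : S → ℝ) (w : S → A) (N : Matrix S S A)

theorem derivation_det_of_displacement
    (hN : ∀ i j, D (N i j) + (x i - x j) • N i j = w j) (hu : IsUnit N.det) :
    D N.det = N.det * ∑ j, Matrix.vecMul w N⁻¹ j := by
  have hadj : N.adjugate = N.det • N⁻¹ := by
    rw [Matrix.inv_def, smul_smul, Ring.mul_inverse_cancel _ hu, one_smul]
  have hD : ∀ i j, D (N i j) = w j - (x i - x j) • N i j := fun i j => eq_sub_of_add_eq (hN i j)
  have h1 : ∑ i, ∑ j, N.adjugate i j * ((x j - x i) • N j i) = 0 := by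
    have e1 : ∑ i, ∑ j, N.adjugate i j * (x j • N j i) = ∑ j, x j • N.det := by
      rw [sum_comm]
      refine sum_congr rfl fun j _ => ?_
      have := congrFun (congrFun N.mul_adjugate j) j
      rw [Matrix.mul_apply, Matrix.smul_apply, Matrix.one_apply_eq, smul_eq_mul, mul_one] at this
      rw [← this, smul_sum]
      exact sum_congr rfl fun i _ => by rw [mul_smul_comm, mul_comm]
    have e2 : ∑ i, ∑ j, N.adjugate i j * (x i • N j i) = ∑ i, x i • N.det := by
      refine sum_congr rfl fun i _ => ?_
      have := congrFun (congrFun N.adjugate_mul i) i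
      rw [Matrix.mul_apply, Matrix.smul_apply, Matrix.one_apply_eq, smul_eq_mul, mul_one] at this
      rw [← this, smul_sum]
      exact sum_congr rfl fun j _ => by rw [mul_smul_comm]
    simp_rw [sub_smul, mul_sub, sum_sub_distrib]
    rw [e1, e2, sub_self]
  rw [D.map_det, Matrix.trace]
  simp_rw [Matrix.diag_apply, Matrix.mul_apply, Matrix.map_apply, hD, mul_sub, sum_sub_distrib]
  rw [h1, sub_zero, hadj, mul_sum, sum_comm]
  refine sum_congr rfl fun j _ => ?_
  rw [Matrix.vecMul, dotProduct, mul_sum]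
  exact sum_congr rfl fun i _ => by rw [Matrix.smul_apply, smul_eq_mul]; ring

theorem derivation_vecMul_inv_of_displacement
    (hN : ∀ i j, D (N i j) + (x i - x j) • N i j = w j) (hu : IsUnit N.det)
    (y : ℝ) (k : S → A) (hk : ∀ j, D (k j) + (y - x j) • k j = w j) (j : S) :
    D (Matrix.vecMul k N⁻¹ j) + (y - x j) • Matrix.vecMul k N⁻¹ j =
      (1 - ∑ i, Matrix.vecMul k N⁻¹ i) * Matrix.vecMul w N⁻¹ j := by
  set ρ := Matrix.vecMul k N⁻¹ with hρ
  have hρN : ∀ j, ∑ i, ρ i * N i j = k j := fun j => by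
    have : Matrix.vecMul ρ N = k := by
      rw [hρ, Matrix.vecMul_vecMul, Matrix.nonsing_inv_mul _ hu, Matrix.vecMul_one]
    exact congrFun this j
  have hσ : Matrix.vecMul (fun i => D (ρ i) + (y - x i) • ρ i) N = (1 - ∑ i, ρ i) • w := by
    ext j
    have e1 : ∑ i, (ρ i * D (N i j) + N i j * D (ρ i)) = D (k j) := by
      rw [← hρN j, map_sum]
      exact sum_congr rfl fun i _ => by rw [D.leibniz]; rfl
    have e2 : ∀ i, (D (ρ i) + (y - x i) • ρ i) * N i j =
        (ρ i * D (N i j) + N i j * D (ρ i)) - ρ i * w j + (y - x j) • (ρ i * N i j) := by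
      intro i
      rw [← hN i j]
      simp only [sub_smul, mul_add, add_mul, sub_mul, mul_sub, smul_mul_assoc, mul_smul_comm]
      ring
    rw [Matrix.vecMul, dotProduct, sum_congr rfl fun i _ => e2 i, sum_add_distrib,
      sum_sub_distrib, e1, ← smul_sum, hρN, ← sum_mul, sub_add_eq_add_sub, hk]
    simp [sub_mul]
  have := congrArg (fun v => Matrix.vecMul v N⁻¹ j) hσ
  simpa only [Matrix.vecMul_vecMul, Matrix.mul_nonsing_inv _ hu, Matrix.vecMul_one,
    Matrix.smul_vecMul, Pi.smul_apply, smul_eq_mul] using this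

end Riccati

/-- The Euler derivation `t d/dt` on formal power series. -/
noncomputable def eulerDerivation : Derivation ℝ (PowerSeries ℝ) (PowerSeries ℝ) :=
  (PowerSeries.X : PowerSeries ℝ) • PowerSeries.derivative ℝ

theorem coeff_eulerDerivation (f : PowerSeries ℝ) (n : ℕ) :
    PowerSeries.coeff n (eulerDerivation f) = n * PowerSeries.coeff n f := by
  rw [eulerDerivation, Derivation.smul_apply, smul_eq_mul]
  cases n with
  | zero => simp
  | succ n =>
    rw [PowerSeries.coeff_succ_X_mul, PowerSeries.coeff_derivative]
    push_cast
    ring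

section Kernel

variable {L : ℕ} {X : Fin (L + 1) → ℝ} (Y : Fin L → ℝ) (u₀ : ℝ)

theorem stepWeight_succ_succ (hX : Function.Injective X) (hgen : IsGeneric L X)
    (i : Fin (L + 1)) (b : ℕ) :
    stepWeight L X Y i (b + 2) =
      ∑ y, muWeight L X Y y * (stepWeight L X Y i (b + 1) / (X y - X i + (b + 1 : ℕ))) := by
  have h := cauchyG_eq_sum hX Y (z := X i - 1 - b) fun j h => by
    refine hgen.add_ne_zero j i (Nat.succ_ne_zero b) ?_
    push_cast
    linarith
  have h2 : stepWeight L X Y i (b + 2) =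
      -(cauchyG L X Y (X i - 1 - b) * stepWeight L X Y i (b + 1)) := by
    simp only [stepWeight, cauchyGFall, prod_range_succ]
    ring
  rw [h2, h, sum_mul, ← sum_neg_distrib]
  refine sum_congr rfl fun y _ => ?_
  have : X y - X i + (b + 1 : ℕ) = -(X i - 1 - b - X y) := by push_cast; ring
  rw [this]
  simp only [div_neg]
  ring

/-- The generating series of `stepWeight`. -/
noncomputable def stepSeries (L : ℕ) (X : Fin (L + 1) → ℝ) (Y : Fin L → ℝ)
    (i : Fin (L + 1)) : PowerSeries ℝ :=
  PowerSeries.mk (stepWeight L X Y i)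

theorem eulerDerivation_momentKernel (hgen : IsGeneric L X) (y i : Fin (L + 1)) :
    eulerDerivation (momentKernel L X Y y i) + (X y - X i) • momentKernel L X Y y i =
      stepSeries L X Y i := by
  ext b
  rw [map_add, coeff_eulerDerivation, PowerSeries.coeff_smul, momentKernel, stepSeries,
    PowerSeries.coeff_mk, PowerSeries.coeff_mk]
  cases b with
  | zero => simp [stepWeight]
  | succ b =>
    have := hgen.add_ne_zero y i (Nat.succ_ne_zero b)
    rw [smul_eq_mul, ← add_mul, add_comm, mul_div_cancel₀ _ this]

theorem sum_X_mul_momentKernel (hX : Function.Injective X) (hgen : IsGeneric L X)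
    (i : Fin (L + 1)) :
    ∑ y, PowerSeries.X * PowerSeries.C (muWeight L X Y y) * momentKernel L X Y y i +
      PowerSeries.X * PowerSeries.C (muWeight L X Y i) = stepSeries L X Y i := by
  ext b
  rw [map_add, map_sum]
  simp_rw [mul_assoc]
  rcases b with - | b
  · simp [stepSeries, stepWeight]
  · simp_rw [PowerSeries.coeff_succ_X_mul, PowerSeries.coeff_C_mul]
    rcases b with - | b
    · simp [stepSeries, momentKernel, stepWeight, cauchyGFall]
    · simp only [stepSeries, momentKernel, PowerSeries.coeff_mk,
        stepWeight_succ_succ Y hX hgen, PowerSeries.coeff_C, Nat.succ_ne_zero, if_false, add_zero]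

theorem isUnit_det_one_add_lowKernel : IsUnit (1 + lowKernel L X Y u₀).det := by
  rw [PowerSeries.isUnit_iff_constantCoeff, RingHom.map_det]
  have : (PowerSeries.constantCoeff (R := ℝ)).mapMatrix (1 + lowKernel L X Y u₀) = 1 := by
    rw [map_add, map_one, add_eq_left]
    ext y i
    simp [lowKernel, momentKernel, stepWeight, ← PowerSeries.coeff_zero_eq_constantCoeff_apply]
  rw [this, Matrix.det_one]
  exact isUnit_one

theorem constantCoeff_det_one_add_lowKernel :
    PowerSeries.coeff 0 (1 + lowKernel L X Y u₀).det = 1 := by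
  rw [PowerSeries.coeff_zero_eq_constantCoeff_apply, RingHom.map_det]
  have : (PowerSeries.constantCoeff (R := ℝ)).mapMatrix (1 + lowKernel L X Y u₀) = 1 := by
    rw [map_add, map_one, add_eq_left]
    ext y i
    simp [lowKernel, momentKernel, stepWeight, ← PowerSeries.coeff_zero_eq_constantCoeff_apply]
  rw [this, Matrix.det_one]

theorem eulerDerivation_one_add_lowKernel (hgen : IsGeneric L X) (y i : {i // X i ≤ u₀}) :
    eulerDerivation ((1 + lowKernel L X Y u₀) y i) +
      (X y - X i) • (1 + lowKernel L X Y u₀) y i = stepSeries L X Y i := by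
  rw [← eulerDerivation_momentKernel Y hgen y i, Matrix.add_apply, map_add, smul_add]
  have : eulerDerivation ((1 : Matrix {i // X i ≤ u₀} {i // X i ≤ u₀} (PowerSeries ℝ)) y i) +
      (X y - X i) • (1 : Matrix {i // X i ≤ u₀} {i // X i ≤ u₀} (PowerSeries ℝ)) y i = 0 := by
    by_cases h : y = i
    · subst h
      rw [Matrix.one_apply_eq, Derivation.map_one_eq_zero, sub_self, zero_smul, add_zero]
    · simp [Matrix.one_apply_ne h]
  rw [add_add_add_comm, this, zero_add]
  rfl

/-- The generating series of the tree sums rooted at the leftmost vertex. -/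
noncomputable def leftSeries (L : ℕ) (X : Fin (L + 1) → ℝ) (Y : Fin L → ℝ) (u₀ : ℝ) :
    {i // X i ≤ u₀} → PowerSeries ℝ :=
  Matrix.vecMul (fun i : {i // X i ≤ u₀} => stepSeries L X Y i) (1 + lowKernel L X Y u₀)⁻¹

/-- The row of the resolvent attached to an arbitrary concave corner. -/
noncomputable def resolventRow (L : ℕ) (X : Fin (L + 1) → ℝ) (Y : Fin L → ℝ) (u₀ : ℝ)
    (y : Fin (L + 1)) : {i // X i ≤ u₀} → PowerSeries ℝ :=
  Matrix.vecMul (fun i : {i // X i ≤ u₀} => momentKernel L X Y y i) (1 + lowKernel L X Y u₀)⁻¹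

/-- The generating series of the tree sums with prescribed leftmost and rightmost vertex. -/
noncomputable def pairSeries (L : ℕ) (X : Fin (L + 1) → ℝ) (Y : Fin L → ℝ) (u₀ : ℝ)
    (y : Fin (L + 1)) (i : {i // X i ≤ u₀}) : PowerSeries ℝ :=
  PowerSeries.X * (PowerSeries.C (muWeight L X Y y) * resolventRow L X Y u₀ y i)

/-- The generating series of the tree sums rooted at the rightmost vertex. -/
noncomputable def rightSeries (L : ℕ) (X : Fin (L + 1) → ℝ) (Y : Fin L → ℝ) (u₀ : ℝ)
    (y : Fin (L + 1)) : PowerSeries ℝ :=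
  -(PowerSeries.X * (PowerSeries.C (muWeight L X Y y) * (1 - ∑ i, resolventRow L X Y u₀ y i)))

theorem eulerDerivation_det (hgen : IsGeneric L X) :
    eulerDerivation (1 + lowKernel L X Y u₀).det =
      (1 + lowKernel L X Y u₀).det * ∑ i, leftSeries L X Y u₀ i :=
  derivation_det_of_displacement _ (fun i : {i // X i ≤ u₀} => X i) _ _
    (eulerDerivation_one_add_lowKernel Y u₀ hgen) (isUnit_det_one_add_lowKernel Y u₀)

theorem coeff_pairSeries (hgen : IsGeneric L X) (y : Fin (L + 1)) (i : {i // X i ≤ u₀}) (j : ℕ) :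
    (X y - X i + (j - 1)) * PowerSeries.coeff j (pairSeries L X Y u₀ y i) =
      -∑ p ∈ antidiagonal j, PowerSeries.coeff p.1 (leftSeries L X Y u₀ i) *
        PowerSeries.coeff p.2 (rightSeries L X Y u₀ y) := by
  have h := derivation_vecMul_inv_of_displacement eulerDerivation (fun i : {i // X i ≤ u₀} => X i)
    _ _ (eulerDerivation_one_add_lowKernel Y u₀ hgen) (isUnit_det_one_add_lowKernel Y u₀)
    (X y) (fun i => momentKernel L X Y y i) (fun i => eulerDerivation_momentKernel Y hgen y i) i
  change eulerDerivation (resolventRow L X Y u₀ y i) + (X y - X i) • resolventRow L X Y u₀ y i =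
    (1 - ∑ i, resolventRow L X Y u₀ y i) * leftSeries L X Y u₀ i at h
  have h' : leftSeries L X Y u₀ i * rightSeries L X Y u₀ y =
      -(PowerSeries.X * (PowerSeries.C (muWeight L X Y y) *
        (eulerDerivation (resolventRow L X Y u₀ y i) +
          (X y - X i) • resolventRow L X Y u₀ y i))) := by
    rw [h, rightSeries]
    ring
  rw [← PowerSeries.coeff_mul, h', map_neg, neg_neg, pairSeries]
  cases j with
  | zero => simp
  | succ j =>
    simp only [PowerSeries.coeff_succ_X_mul, PowerSeries.coeff_C_mul, map_add,
      coeff_eulerDerivation, PowerSeries.coeff_smul, smul_eq_mul]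
    push_cast
    ring

theorem sum_pairSeries_left (y : Fin (L + 1)) :
    ∑ i, pairSeries L X Y u₀ y i =
      PowerSeries.X * PowerSeries.C (muWeight L X Y y) + rightSeries L X Y u₀ y := by
  simp_rw [pairSeries, rightSeries, ← mul_sum]
  ring

theorem sum_pairSeries_right (hX : Function.Injective X) (hgen : IsGeneric L X)
    (i : {i // X i ≤ u₀}) :
    ∑ y ∈ univ.filter (fun y => u₀ < X y), pairSeries L X Y u₀ y i =
      leftSeries L X Y u₀ i - PowerSeries.X * PowerSeries.C (muWeight L X Y i) := by
  set N := 1 + lowKernel L X Y u₀ with hN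
  let t : Fin (L + 1) → PowerSeries ℝ := fun y => PowerSeries.X * PowerSeries.C (muWeight L X Y y)
  have h1 : (fun i : {i // X i ≤ u₀} => ∑ y ∈ univ.filter (fun y => u₀ < X y),
        t y * momentKernel L X Y y i) =
      (fun i : {i // X i ≤ u₀} => stepSeries L X Y i) -
        Matrix.vecMul (fun i : {i // X i ≤ u₀} => t i) N := by
    ext1 i
    rw [Pi.sub_apply, ← sum_X_mul_momentKernel Y hX hgen i, hN, Matrix.vecMul_add,
      Matrix.vecMul_one, Pi.add_apply, Matrix.vecMul, dotProduct]
    have := sum_filter_add_sum_filter_not univ (fun y => u₀ < X y)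
      (fun y => t y * momentKernel L X Y y i)
    rw [← this]
    have e : ∑ y ∈ univ.filter (fun y => ¬ u₀ < X y), t y * momentKernel L X Y y i =
        ∑ y : {i // X i ≤ u₀}, t y * lowKernel L X Y u₀ y i := by
      simp_rw [not_lt]
      exact sum_subtype _ (fun y => by simp) _
    rw [e]
    ring
  have h2 := congrArg (fun v => Matrix.vecMul v N⁻¹ i) h1
  simp only [Matrix.sub_vecMul, Matrix.vecMul_vecMul,
    Matrix.mul_nonsing_inv _ (isUnit_det_one_add_lowKernel Y u₀), Matrix.vecMul_one, N,
    Pi.sub_apply] at h2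
  refine Eq.trans ?_ h2
  simp only [Matrix.vecMul, dotProduct, sum_mul]
  rw [sum_comm]
  refine sum_congr rfl fun y _ => ?_
  rw [pairSeries, resolventRow, Matrix.vecMul, dotProduct, mul_sum, mul_sum]
  exact sum_congr rfl fun k _ => by ring

theorem coeff_zero_leftSeries (i : {i // X i ≤ u₀}) :
    PowerSeries.coeff 0 (leftSeries L X Y u₀ i) = 0 := by
  rw [leftSeries, Matrix.vecMul, dotProduct, map_sum]
  refine sum_eq_zero fun k _ => ?_
  have : PowerSeries.constantCoeff (stepSeries L X Y k) = 0 := by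
    simp [stepSeries, stepWeight, ← PowerSeries.coeff_zero_eq_constantCoeff_apply]
  simp [this]

theorem coeff_zero_rightSeries (y : Fin (L + 1)) :
    PowerSeries.coeff 0 (rightSeries L X Y u₀ y) = 0 := by
  simp [rightSeries]

theorem coeff_one_pairSeries (y : Fin (L + 1)) (i : {i // X i ≤ u₀}) :
    PowerSeries.coeff 1 (pairSeries L X Y u₀ y i) = 0 := by
  rw [pairSeries, ← zero_add 1, PowerSeries.coeff_succ_X_mul, PowerSeries.coeff_C_mul,
    resolventRow, Matrix.vecMul, dotProduct, map_sum, sum_eq_zero, mul_zero]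
  intro k _
  have : PowerSeries.constantCoeff (momentKernel L X Y y k) = 0 := by
    simp [momentKernel, stepWeight, ← PowerSeries.coeff_zero_eq_constantCoeff_apply]
  simp [this]

end Kernel

theorem Relation.ReflTransGen.exists_exit {α : Type*} {R : α → α → Prop} {a v : α}
    (h : Relation.ReflTransGen R a v) {P : α → Prop} (ha : P a) (hv : ¬ P v) :
    ∃ x y, Relation.ReflTransGen R a x ∧ R x y ∧ P x ∧ ¬ P y := by
  induction h with
  | refl => exact absurd ha hv
  | @tail x y hx hxy ih =>
    by_cases hPx : P x
    · exact ⟨x, y, hx, hxy, hPx, hv⟩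
    · exact ih hPx

/-- Two vertices are adjacent if they are joined by an edge of `E`. -/
def EdgeAdj (E : Finset (ℕ × ℕ)) (v w : ℕ) : Prop := (v, w) ∈ E ∨ (w, v) ∈ E

/-- Two vertices are connected by the edges of `E`. -/
def EdgeReach (E : Finset (ℕ × ℕ)) : ℕ → ℕ → Prop := Relation.ReflTransGen (EdgeAdj E)

theorem EdgeReach.symm {E : Finset (ℕ × ℕ)} {v w : ℕ} (h : EdgeReach E v w) : EdgeReach E w v :=
  have : Std.Symm (EdgeAdj E) := ⟨fun _ _ => Or.symm⟩
  (Relation.ReflTransGen.stdSymm (r := EdgeAdj E)).symm _ _ h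

theorem EdgeReach.trans {E : Finset (ℕ × ℕ)} {u v w : ℕ} (h : EdgeReach E u v)
    (h' : EdgeReach E v w) : EdgeReach E u w :=
  Relation.ReflTransGen.trans h h'

theorem EdgeReach.mono {E F : Finset (ℕ × ℕ)} (hEF : E ⊆ F) {v w : ℕ} (h : EdgeReach E v w) :
    EdgeReach F v w := by
  induction h with
  | refl => exact .refl
  | tail _ hxy ih => exact ih.tail (hxy.imp (@hEF _) (@hEF _))

/-- `E` is the edge set of a non-crossing alternating tree on the interval `[a, b]`. -/
structure IsTreeOn (a b : ℕ) (E : Finset (ℕ × ℕ)) : Prop where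
  bounds : ∀ e ∈ E, a ≤ e.1 ∧ e.1 < e.2 ∧ e.2 ≤ b
  card : E.card + a = b
  conn : ∀ v, a ≤ v → v ≤ b → EdgeReach E a v
  nonCrossing : ∀ e ∈ E, ∀ e' ∈ E, ¬ (e.1 < e'.1 ∧ e'.1 < e.2 ∧ e.2 < e'.2)
  alternating : ∀ i v m, (i, v) ∈ E → (v, m) ∈ E → False

theorem le_card_add_of_edgeReach {a b : ℕ} {E : Finset (ℕ × ℕ)}
    (h : ∀ v, a ≤ v → v ≤ b → EdgeReach E a v) (hab : a ≤ b) : b ≤ E.card + a := by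
  have key : ∀ k ≤ b - a, ∃ S : Finset ℕ, a ∈ S ∧ S.card = k + 1 ∧ ∃ F ⊆ E, F.card = k ∧
      ∀ e ∈ F, e.1 ∈ S ∧ e.2 ∈ S := by
    intro k
    induction k with
    | zero => exact fun _ => ⟨{a}, by simp, by simp, ∅, by simp⟩
    | succ k ih =>
      intro hk
      obtain ⟨S, haS, hS, F, hFE, hF, hFS⟩ := ih (by omega)
      obtain ⟨v, hv, hvS⟩ : ∃ v ∈ Icc a b, v ∉ S := by
        by_contra! hc
        have := card_le_card hc
        rw [Nat.card_Icc] at this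
        omega
      rw [mem_Icc] at hv
      obtain ⟨x, y, -, hxy, hx, hy⟩ :=
        Relation.ReflTransGen.exists_exit (h v hv.1 hv.2) (P := (· ∈ S)) haS hvS
      obtain ⟨e, he, heS, hey⟩ : ∃ e ∈ E, (e.1 ∉ S ∨ e.2 ∉ S) ∧
          e.1 ∈ insert y S ∧ e.2 ∈ insert y S := by
        rcases hxy with h | h
        · exact ⟨_, h, Or.inr hy, by simp [hx], by simp⟩
        · exact ⟨_, h, Or.inl hy, by simp, by simp [hx]⟩
      have heF : e ∉ F := fun h => by
        have := hFS e h
        tauto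
      refine ⟨insert y S, mem_insert_of_mem haS, by rw [card_insert_of_notMem hy, hS],
        insert e F, insert_subset he hFE, by rw [card_insert_of_notMem heF, hF], ?_⟩
      intro f hf
      rcases mem_insert.1 hf with rfl | hf
      · exact hey
      · exact ⟨mem_insert_of_mem (hFS f hf).1, mem_insert_of_mem (hFS f hf).2⟩
  obtain ⟨S, -, -, F, hFE, hF, -⟩ := key (b - a) le_rfl
  have := card_le_card hFE
  omega

namespace IsTreeOn

variable {a b m : ℕ} {E E₁ E₂ : Finset (ℕ × ℕ)}

theorem le (h : IsTreeOn a b E) : a ≤ b := by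
  have := h.card
  omega

theorem exists_adj (h : IsTreeOn a b E) (hab : a < b) {v : ℕ} (hav : a ≤ v) (hvb : v ≤ b) :
    ∃ w, EdgeAdj E v w := by
  obtain ⟨w, hw, hwb, hne⟩ : ∃ w, a ≤ w ∧ w ≤ b ∧ w ≠ v := by
    by_cases hv : v = a
    · exact ⟨b, by omega, le_rfl, by omega⟩
    · exact ⟨a, le_rfl, by omega, Ne.symm hv⟩
  obtain ⟨x, y, -, hxy, rfl, -⟩ := Relation.ReflTransGen.exists_exit
    ((h.conn v hav hvb).symm.trans (h.conn w hw hwb)) (P := (· = v)) rfl hne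
  exact ⟨y, hxy⟩

theorem no_incoming_iff (h : IsTreeOn a b E) (hab : a < b) {v : ℕ} (hav : a ≤ v) (hvb : v ≤ b) :
    (∀ i, (i, v) ∉ E) ↔ ∃ w, (v, w) ∈ E := by
  constructor
  · intro hi
    obtain ⟨w, hw | hw⟩ := h.exists_adj hab hav hvb
    · exact ⟨w, hw⟩
    · exact absurd hw (hi w)
  · rintro ⟨w, hw⟩ i hi
    exact h.alternating i v w hi hw

theorem mem_of_lt (h : IsTreeOn a b E) (hab : a < b) : (a, b) ∈ E := by
  have hne : (E.filter fun e => e.1 = a).Nonempty := by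
    obtain ⟨w, hw | hw⟩ := h.exists_adj hab le_rfl hab.le
    · exact ⟨_, mem_filter.2 ⟨hw, rfl⟩⟩
    · have := h.bounds _ hw
      dsimp only at this
      omega
  obtain ⟨⟨a', m⟩, hm, hmax⟩ := exists_max_image _ (fun e => e.2) hne
  simp only [mem_filter] at hm hmax
  obtain ⟨hm, rfl⟩ := hm
  by_cases hmb : m = b
  · exact hmb ▸ hm
  · have hm' := h.bounds _ hm
    dsimp only at hm'
    obtain ⟨x, y, -, hxy, hx, hy⟩ := Relation.ReflTransGen.exists_exit (h.conn b hab.le le_rfl)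
      (P := (· ≤ m)) (by omega) (by omega)
    have hxy' : (x, y) ∈ E := by
      rcases hxy with hxy | hxy
      · exact hxy
      · have := h.bounds _ hxy
        dsimp only at this
        omega
    have h1 := h.bounds _ hxy'
    have h2 := h.nonCrossing _ hm _ hxy'
    dsimp only at h1 h2
    have h3 : x ≠ a' := fun hc => hy (hmax (x, y) ⟨hxy', hc⟩)
    have h4 : x ≠ m := fun hc => h.alternating _ _ _ hm (hc ▸ hxy')
    omega

theorem of_subset (h : IsTreeOn a b E) {a' b' : ℕ} {E' : Finset (ℕ × ℕ)} (hE : E' ⊆ E)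
    (hb : ∀ e ∈ E', a' ≤ e.1 ∧ e.2 ≤ b') (hcard : E'.card + a' = b')
    (hconn : ∀ v, a' ≤ v → v ≤ b' → EdgeReach E' a' v) : IsTreeOn a' b' E' where
  bounds e he := ⟨(hb e he).1, (h.bounds e (hE he)).2.1, (hb e he).2⟩
  card := hcard
  conn := hconn
  nonCrossing e he e' he' := h.nonCrossing e (hE he) e' (hE he')
  alternating i v m hi hm := h.alternating i v m (hE hi) (hE hm)

theorem join (h₁ : IsTreeOn a m E₁) (h₂ : IsTreeOn (m + 1) b E₂) :
    IsTreeOn a b (insert (a, b) (E₁ ∪ E₂)) := by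
  have l₁ := h₁.le
  have l₂ := h₂.le
  have s₁ : E₁ ⊆ insert (a, b) (E₁ ∪ E₂) := fun e he => by simp [he]
  have s₂ : E₂ ⊆ insert (a, b) (E₁ ∪ E₂) := fun e he => by simp [he]
  refine ⟨?_, ?_, ?_, ?_, ?_⟩
  · intro e he
    simp only [mem_insert, mem_union] at he
    rcases he with rfl | he | he
    · dsimp only
      omega
    · have := h₁.bounds e he
      omega
    · have := h₂.bounds e he
      omega
  · have hd : Disjoint E₁ E₂ := disjoint_left.2 fun e he he' => by
      have := h₁.bounds e he
      have := h₂.bounds e he'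
      omega
    have hn : (a, b) ∉ E₁ ∪ E₂ := fun he => by
      rcases mem_union.1 he with he | he
      · have := h₁.bounds _ he
        dsimp only at this
        omega
      · have := h₂.bounds _ he
        dsimp only at this
        omega
    rw [card_insert_of_notMem hn, card_union_of_disjoint hd]
    have := h₁.card
    have := h₂.card
    omega
  · intro v hv hvb
    by_cases hvm : v ≤ m
    · exact (h₁.conn v hv hvm).mono s₁
    · have hab : EdgeReach (insert (a, b) (E₁ ∪ E₂)) a b :=
        Relation.ReflTransGen.single (Or.inl (mem_insert_self _ _))
      exact hab.trans (((h₂.conn b l₂ le_rfl).symm.trans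
        (h₂.conn v (by omega) hvb)).mono s₂)
  · intro e he e' he'
    simp only [mem_insert, mem_union] at he he'
    rcases he with rfl | he | he <;> rcases he' with rfl | he' | he'
    · omega
    · have := h₁.bounds _ he'
      dsimp only
      omega
    · have := h₂.bounds _ he'
      dsimp only
      omega
    · have := h₁.bounds _ he
      dsimp only
      omega
    · exact h₁.nonCrossing e he e' he'
    · have := h₁.bounds _ he
      have := h₂.bounds _ he'
      omega
    · have := h₂.bounds _ he
      dsimp only
      omega
    · have := h₂.bounds _ he
      have := h₁.bounds _ he'
      omega
    · exact h₂.nonCrossing e he e' he'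
  · intro i v w hi hw
    simp only [mem_insert, mem_union, Prod.mk.injEq] at hi hw
    rcases hi with hi | hi | hi <;> rcases hw with hw | hw | hw
    · omega
    · have := h₁.bounds _ hw
      dsimp only at this
      omega
    · have := h₂.bounds _ hw
      dsimp only at this
      omega
    · have := h₁.bounds _ hi
      dsimp only at this
      omega
    · exact h₁.alternating _ _ _ hi hw
    · have h1 := h₁.bounds _ hi
      have h2 := h₂.bounds _ hw
      dsimp only at h1 h2
      omega
    · have := h₂.bounds _ hi
      dsimp only at this
      omega
    · have h1 := h₂.bounds _ hi
      have h2 := h₁.bounds _ hw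
      dsimp only at h1 h2
      omega
    · exact h₂.alternating _ _ _ hi hw

theorem edgeReach_erase (h : IsTreeOn a b E) {v : ℕ} (hv : EdgeReach E a v) :
    EdgeReach (E.erase (a, b)) a v ∨ EdgeReach (E.erase (a, b)) b v := by
  induction hv with
  | refl => exact Or.inl .refl
  | @tail x y hx hxy ih =>
    by_cases hy : y = a ∨ y = b
    · rcases hy with rfl | rfl
      · exact Or.inl .refl
      · exact Or.inr .refl
    · have hxy' : EdgeAdj (E.erase (a, b)) x y := by
        refine hxy.imp (fun he => mem_erase.2 ⟨?_, he⟩) (fun he => mem_erase.2 ⟨?_, he⟩) <;>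
        · rw [Ne, Prod.mk.injEq]
          tauto
      exact ih.imp (fun h => h.tail hxy') (fun h => h.tail hxy')

theorem not_edgeReach_erase (h : IsTreeOn a b E) (hab : a < b) :
    ¬ EdgeReach (E.erase (a, b)) a b := by
  intro hr
  have := le_card_add_of_edgeReach (E := E.erase (a, b)) (a := a) (b := b)
    (fun v hv hvb => (h.edgeReach_erase (h.conn v hv hvb)).elim id hr.trans) hab.le
  rw [card_erase_of_mem (h.mem_of_lt hab)] at this
  have := h.card
  omega

theorem exists_split (h : IsTreeOn a b E) (hab : a < b) :
    ∃ m E₁ E₂, a ≤ m ∧ m < b ∧ IsTreeOn a m E₁ ∧ IsTreeOn (m + 1) b E₂ ∧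
      E = insert (a, b) (E₁ ∪ E₂) := by
  set E' := E.erase (a, b) with hE'
  have hsub : E' ⊆ E := erase_subset _ _
  have hbd : ∀ e ∈ E', a ≤ e.1 ∧ e.1 < e.2 ∧ e.2 ≤ b := fun e he => h.bounds e (hsub he)
  have hle : ∀ v, EdgeReach E' a v → v ≤ b := by
    intro v hv
    by_contra hc
    obtain ⟨x, y, -, hxy, hx, hy⟩ :=
      Relation.ReflTransGen.exists_exit hv (P := (· ≤ b)) hab.le hc
    rcases hxy with hxy | hxy
    · have := hbd _ hxy
      dsimp only at this
      omega
    · have := hbd _ hxy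
      dsimp only at this
      omega
  obtain ⟨m, hm, hmax⟩ := exists_max_image ((Icc a b).filter (EdgeReach E' a)) id
    ⟨a, mem_filter.2 ⟨left_mem_Icc.2 hab.le, .refl⟩⟩
  simp only [mem_filter, mem_Icc, id] at hm hmax
  obtain ⟨⟨ham, hmb⟩, hm⟩ := hm
  have hmb' : m ≠ b := by
    rintro rfl
    exact h.not_edgeReach_erase hab hm
  have hcross : ∀ e ∈ E', ¬ (e.1 ≤ m ∧ m < e.2) := by
    rintro ⟨c, d⟩ he ⟨hc, hd⟩
    dsimp only at hc hd
    have hcd := hbd _ he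
    dsimp only at hcd
    have hda : ¬ EdgeReach E' a d := fun hr => by
      have := hmax d ⟨by omega, hr⟩
      omega
    have hca : ¬ EdgeReach E' a c := fun hr => hda (hr.tail (Or.inl he))
    have hne : c ≠ a := fun hc => hca (hc ▸ .refl)
    have hne' : c ≠ m := fun hc => hca (hc ▸ hm)
    obtain ⟨x, y, hax, hxy, hx, hy⟩ :=
      Relation.ReflTransGen.exists_exit hm (P := (· < c)) (by omega) (by omega)
    have hay : EdgeReach E' a y := hax.tail hxy
    have hyc : y ≠ c := fun hc => hca (hc ▸ hay)
    have hyb := hle y hay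
    have hym := hmax y ⟨by omega, hay⟩
    rcases hxy with hxy | hxy
    · have := h.nonCrossing _ (hsub hxy) _ (hsub he)
      dsimp only at this
      omega
    · have := hbd _ hxy
      dsimp only at this
      omega
  set E₁ := E'.filter (fun e => e.2 ≤ m) with hE₁
  set E₂ := E'.filter (fun e => ¬ e.2 ≤ m) with hE₂
  have hunion : E₁ ∪ E₂ = E' := filter_union_filter_not_eq _ _
  have hleft : ∀ v, EdgeReach E' a v → v ≤ m ∧ EdgeReach E₁ a v := by
    intro v hv
    induction hv with
    | refl => exact ⟨ham, .refl⟩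
    | @tail x y hx hxy ih =>
      rcases hxy with hxy | hxy
      · have h1 := hcross _ hxy
        dsimp only at h1
        exact ⟨by omega, ih.2.tail (Or.inl (mem_filter.2 ⟨hxy, by dsimp only; omega⟩))⟩
      · have h1 := hbd _ hxy
        dsimp only at h1
        exact ⟨by omega, ih.2.tail (Or.inr (mem_filter.2 ⟨hxy, by dsimp only; omega⟩))⟩
  have hright : ∀ v, EdgeReach E' b v → m < v ∧ EdgeReach E₂ b v := by
    intro v hv
    induction hv with
    | refl => exact ⟨by omega, .refl⟩
    | @tail x y hx hxy ih =>
      rcases hxy with hxy | hxy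
      · have h1 := hbd _ hxy
        dsimp only at h1
        exact ⟨by omega, ih.2.tail (Or.inl (mem_filter.2 ⟨hxy, by dsimp only; omega⟩))⟩
      · have h1 := hcross _ hxy
        dsimp only at h1
        exact ⟨by omega, ih.2.tail (Or.inr (mem_filter.2 ⟨hxy, by dsimp only; omega⟩))⟩
  have hconn₁ : ∀ v, a ≤ v → v ≤ m → EdgeReach E₁ a v := by
    intro v hv hvm
    rcases h.edgeReach_erase (h.conn v hv (by omega)) with hr | hr
    · exact (hleft v hr).2
    · have := (hright v hr).1
      omega
  have hconnb : ∀ v, m + 1 ≤ v → v ≤ b → EdgeReach E₂ b v := by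
    intro v hv hvb
    rcases h.edgeReach_erase (h.conn v (by omega) hvb) with hr | hr
    · have := (hleft v hr).1
      omega
    · exact (hright v hr).2
  have hconn₂ : ∀ v, m + 1 ≤ v → v ≤ b → EdgeReach E₂ (m + 1) v := fun v hv hvb =>
    (hconnb (m + 1) le_rfl (by omega)).symm.trans (hconnb v hv hvb)
  have hc₁ := le_card_add_of_edgeReach hconn₁ ham
  have hc₂ := le_card_add_of_edgeReach hconn₂ (by omega)
  have hc : E₁.card + E₂.card = E'.card := card_filter_add_card_filter_not _
  have hc' := card_erase_of_mem (h.mem_of_lt hab)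
  rw [← hE'] at hc'
  have hcE := h.card
  refine ⟨m, E₁, E₂, ham, by omega, h.of_subset ((filter_subset _ _).trans hsub) ?_ (by omega)
    hconn₁, h.of_subset ((filter_subset _ _).trans hsub) ?_ (by omega) hconn₂, ?_⟩
  · intro e he
    have := mem_filter.1 he
    exact ⟨(hbd e this.1).1, this.2⟩
  · intro e he
    have h1 := mem_filter.1 he
    have h2 := hcross e h1.1
    have h3 := hbd e h1.1
    omega
  · rw [hunion, hE', insert_erase (h.mem_of_lt hab)]

theorem le_of_join_eq {m' : ℕ} {E₁' E₂' : Finset (ℕ × ℕ)} (h₁ : IsTreeOn a m E₁)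
    (h₂ : IsTreeOn (m + 1) b E₂) (h₁' : IsTreeOn a m' E₁') (h₂' : IsTreeOn (m' + 1) b E₂')
    (h : insert (a, b) (E₁ ∪ E₂) = insert (a, b) (E₁' ∪ E₂')) : m' ≤ m := by
  by_contra! hc
  obtain ⟨x, y, -, hxy, hx, hy⟩ := Relation.ReflTransGen.exists_exit (h₁'.conn m' h₁'.le le_rfl)
    (P := (· ≤ m)) h₁.le (by omega)
  have l := h₂'.le
  rcases hxy with hxy | hxy
  · have hb := h₁'.bounds _ hxy
    dsimp only at hb
    have hmem : (x, y) ∈ insert (a, b) (E₁ ∪ E₂) := by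
      rw [h]
      simp [hxy]
    simp only [mem_insert, mem_union, Prod.mk.injEq] at hmem
    rcases hmem with hmem | hmem | hmem
    · omega
    · have := h₁.bounds _ hmem
      dsimp only at this
      omega
    · have := h₂.bounds _ hmem
      dsimp only at this
      omega
  · have hb := h₁'.bounds _ hxy
    dsimp only at hb
    omega

theorem eq_filter_join (h₁ : IsTreeOn a m E₁) (h₂ : IsTreeOn (m + 1) b E₂) :
    E₁ = (insert (a, b) (E₁ ∪ E₂)).filter (fun e => e.2 ≤ m) ∧
      E₂ = (insert (a, b) (E₁ ∪ E₂)).filter (fun e => m < e.1) := by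
  have l₁ := h₁.le
  have l₂ := h₂.le
  constructor
  · ext e
    simp only [mem_filter, mem_insert, mem_union]
    constructor
    · exact fun he => ⟨Or.inr (Or.inl he), (h₁.bounds e he).2.2⟩
    · rintro ⟨rfl | he | he, hm⟩
      · dsimp only at hm
        omega
      · exact he
      · have := h₂.bounds e he
        omega
  · ext e
    simp only [mem_filter, mem_insert, mem_union]
    constructor
    · exact fun he => ⟨Or.inr (Or.inr he), (h₂.bounds e he).1⟩
    · rintro ⟨rfl | he | he, hm⟩
      · dsimp only at hm
        omega
      · have := h₁.bounds e he
        omega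
      · exact he

end IsTreeOn

/-- The non-crossing alternating trees on the interval `[a, b]`. -/
noncomputable def treesOn (a b : ℕ) : Finset (Finset (ℕ × ℕ)) :=
  (Icc a b ×ˢ Icc a b).powerset.filter (IsTreeOn a b)

theorem mem_treesOn {a b : ℕ} {E : Finset (ℕ × ℕ)} : E ∈ treesOn a b ↔ IsTreeOn a b E := by
  rw [treesOn, mem_filter, and_iff_right_iff_imp]
  intro h
  refine mem_powerset.2 fun e he => ?_
  have := h.bounds e he
  rw [mem_product, mem_Icc, mem_Icc]
  omega

theorem treesOn_self (a : ℕ) : treesOn a a = {∅} := by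
  ext E
  rw [mem_treesOn, mem_singleton]
  constructor
  · intro h
    have := h.card
    exact card_eq_zero.1 (by omega)
  · rintro rfl
    refine ⟨by simp, by simp, fun v hv hv' => ?_, by simp, by simp⟩
    rw [le_antisymm hv' hv]
    exact .refl

theorem sum_treesOn {a b : ℕ} (hab : a < b) (f : Finset (ℕ × ℕ) → ℝ) :
    ∑ E ∈ treesOn a b, f E = ∑ m ∈ Ico a b, ∑ E₁ ∈ treesOn a m, ∑ E₂ ∈ treesOn (m + 1) b,
      f (insert (a, b) (E₁ ∪ E₂)) := by
  simp_rw [← sum_product', sum_sigma']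
  symm
  refine sum_bij (fun p _ => insert (a, b) (p.2.1 ∪ p.2.2)) ?_ ?_ ?_ fun _ _ => rfl
  · rintro ⟨m, E₁, E₂⟩ hp
    simp only [mem_sigma, mem_product, mem_treesOn] at hp
    exact mem_treesOn.2 (hp.2.1.join hp.2.2)
  · rintro ⟨m, E₁, E₂⟩ hp ⟨m', E₁', E₂'⟩ hp' heq
    simp only [mem_sigma, mem_product, mem_treesOn] at hp hp' heq
    obtain ⟨-, h₁, h₂⟩ := hp
    obtain ⟨-, h₁', h₂'⟩ := hp'
    obtain rfl := le_antisymm (h₁'.le_of_join_eq h₂' h₁ h₂ heq.symm)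
      (h₁.le_of_join_eq h₂ h₁' h₂' heq)
    have e := h₁.eq_filter_join h₂
    have e' := h₁'.eq_filter_join h₂'
    rw [heq, ← e'.1, ← e'.2] at e
    rw [e.1, e.2]
  · intro E hE
    obtain ⟨m, E₁, E₂, ham, hmb, h₁, h₂, rfl⟩ := (mem_treesOn.1 hE).exists_split hab
    exact ⟨⟨m, E₁, E₂⟩, by simp [mem_treesOn, *], rfl⟩

section Words

variable {ι : Type*} [Fintype ι] [AddCommMonoid ι]

/-- Labellings of the vertices in `s` (extended by `0`). -/
noncomputable def words (ι : Type*) [Fintype ι] [AddCommMonoid ι] (s : Finset ℕ) :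
    Finset (ℕ →₀ ι) :=
  s.finsupp fun _ => univ

theorem mem_words {s : Finset ℕ} {r : ℕ →₀ ι} : r ∈ words ι s ↔ r.support ⊆ s := by
  simp [words, mem_finsupp_iff]

theorem sum_words_union {s t : Finset ℕ} (hst : Disjoint s t) (F G : (ℕ →₀ ι) → ℝ)
    (hF : ∀ r r' : ℕ →₀ ι, (∀ v ∈ s, r v = r' v) → F r = F r')
    (hG : ∀ r r' : ℕ →₀ ι, (∀ v ∈ t, r v = r' v) → G r = G r') :
    ∑ r ∈ words ι (s ∪ t), F r * G r = (∑ r ∈ words ι s, F r) * ∑ r ∈ words ι t, G r := by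
  have hd : ∀ v, v ∈ s → v ∉ t := fun _ hv => disjoint_left.1 hst hv
  have hz : ∀ {u : Finset ℕ} {r : ℕ →₀ ι}, r ∈ words ι u → ∀ v, v ∉ u → r v = 0 := by
    intro u r hr v hv
    by_contra hc
    exact hv (mem_words.1 hr (Finsupp.mem_support_iff.2 hc))
  have hw : ∀ {u : Finset ℕ} {r : ℕ →₀ ι}, (∀ v, v ∉ u → r v = 0) → r ∈ words ι u := by
    intro u r h
    rw [mem_words]
    intro v hv
    by_contra hc
    exact Finsupp.mem_support_iff.1 hv (h v hc)
  rw [sum_mul_sum, ← sum_product']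
  refine sum_bij' (fun r _ => (r.filter (· ∈ s), r.filter (· ∈ t))) (fun p _ => p.1 + p.2)
    ?_ ?_ ?_ ?_ ?_
  · intro r hr
    rw [mem_product]
    exact ⟨hw fun v hv => Finsupp.filter_apply_neg _ _ hv,
      hw fun v hv => Finsupp.filter_apply_neg _ _ hv⟩
  · intro p hp
    rw [mem_product] at hp
    refine hw fun v hv => ?_
    rw [mem_union, not_or] at hv
    rw [Finsupp.add_apply, hz hp.1 v hv.1, hz hp.2 v hv.2, add_zero]
  · intro r hr
    ext v
    rw [Finsupp.add_apply, Finsupp.filter_apply, Finsupp.filter_apply]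
    by_cases hs : v ∈ s
    · rw [if_pos hs, if_neg (hd v hs), add_zero]
    · by_cases ht : v ∈ t
      · rw [if_neg hs, if_pos ht, zero_add]
      · rw [if_neg hs, if_neg ht, add_zero, hz hr v (by simp [hs, ht])]
  · rintro ⟨p, q⟩ hp
    rw [mem_product] at hp
    refine Prod.ext ?_ ?_
    · ext v
      by_cases hs : v ∈ s
      · rw [Finsupp.filter_apply_pos _ _ hs, Finsupp.add_apply, hz hp.2 v (hd v hs), add_zero]
      · rw [Finsupp.filter_apply_neg _ _ hs, hz hp.1 v hs]
    · ext v
      by_cases ht : v ∈ t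
      · rw [Finsupp.filter_apply_pos _ _ ht, Finsupp.add_apply, hz hp.1 v fun hs => hd v hs ht,
          zero_add]
      · rw [Finsupp.filter_apply_neg _ _ ht, hz hp.2 v ht]
  · intro r _
    congr 1
    · exact hF _ _ fun v hv => (Finsupp.filter_apply_pos _ _ hv).symm
    · exact hG _ _ fun v hv => (Finsupp.filter_apply_pos _ _ hv).symm

theorem sum_words_singleton (a : ℕ) (F : ι → ℝ) :
    ∑ r ∈ words ι {a}, F (r a) = ∑ x, F x := by
  refine sum_bij' (fun r _ => r a) (fun x _ => Finsupp.single a x) ?_ ?_ ?_ ?_ ?_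
  · simp
  · intro x _
    exact mem_words.2 Finsupp.support_single_subset
  · intro r hr
    ext v
    by_cases hv : v = a
    · rw [hv, Finsupp.single_eq_same]
    · rw [Finsupp.single_eq_of_ne hv]
      by_contra hc
      exact hv (mem_singleton.1 (mem_words.1 hr (Finsupp.mem_support_iff.2 (Ne.symm hc))))
  · simp
  · simp

theorem sum_words_range (n : ℕ) (F : (Fin n → ι) → ℝ) :
    ∑ r ∈ words ι (range n), F (fun v => r v) = ∑ r, F r := by
  refine sum_bij (fun r _ v => r v) ?_ ?_ ?_ ?_
  · simp
  · intro r hr r' hr' h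
    ext v
    by_cases hv : v < n
    · exact congrFun h ⟨v, hv⟩
    · have h1 : ∀ r ∈ words ι (range n), r v = 0 := fun r hr => by
        by_contra hc
        exact hv (mem_range.1 (mem_words.1 hr (Finsupp.mem_support_iff.2 hc)))
      rw [h1 r hr, h1 r' hr']
  · intro f _
    refine ⟨Finsupp.onFinset (range n) (fun v => if h : v < n then f ⟨v, h⟩ else 0) ?_, ?_, ?_⟩
    · intro v hv
      by_contra hc
      exact hv (dif_neg fun h => hc (mem_range.2 h))
    · exact mem_words.2 Finsupp.support_onFinset_subset
    · ext1 v
      rw [Finsupp.onFinset_apply, dif_pos v.2]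
  · simp

end Words

theorem IsTreeOn.edges_subset {a b : ℕ} {E : Finset (ℕ × ℕ)} (h : IsTreeOn a b E) :
    ∀ e ∈ E, e.1 ∈ Icc a b ∧ e.2 ∈ Icc a b := by
  intro e he
  have := h.bounds e he
  simp only [mem_Icc]
  omega

section Weight

variable {ι : Type*} [AddCommMonoid ι]

/-- The signed weight of a labelled edge set on the vertices `s`, given edge weights `q`, vertex
weights `gb` and `gw` for the two colours, and the set `B` of vertices of the first colour. -/
noncomputable def edgeSetWeight (q : ℕ → ι → ι → ℝ) (gb gw : ι → ℝ) (s : Finset ℕ)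
    (B : ℕ → Prop) (E : Finset (ℕ × ℕ)) (r : ℕ →₀ ι) : ℝ :=
  -((∏ e ∈ E, q (e.2 - e.1) (r e.1) (r e.2)) * ∏ v ∈ s, if B v then gb (r v) else gw (r v))

variable (q : ℕ → ι → ι → ℝ) (gb gw : ι → ℝ)

theorem edgeSetWeight_congr {s : Finset ℕ} {B B' : ℕ → Prop} {E : Finset (ℕ × ℕ)}
    {r r' : ℕ →₀ ι} (hE : ∀ e ∈ E, e.1 ∈ s ∧ e.2 ∈ s) (hB : ∀ v ∈ s, (B v ↔ B' v))
    (hr : ∀ v ∈ s, r v = r' v) :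
    edgeSetWeight q gb gw s B E r = edgeSetWeight q gb gw s B' E r' := by
  unfold edgeSetWeight
  congr 2
  · exact prod_congr rfl fun e he => by rw [hr _ (hE e he).1, hr _ (hE e he).2]
  · refine prod_congr rfl fun v hv => ?_
    rw [hr v hv]
    simp only [hB v hv]

theorem edgeSetWeight_join {a b m : ℕ} {E₁ E₂ : Finset (ℕ × ℕ)} (h₁ : IsTreeOn a m E₁)
    (h₂ : IsTreeOn (m + 1) b E₂) (r : ℕ →₀ ι) :
    edgeSetWeight q gb gw (Icc a b) (fun v => ∀ i, (i, v) ∉ insert (a, b) (E₁ ∪ E₂))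
        (insert (a, b) (E₁ ∪ E₂)) r =
      -q (b - a) (r a) (r b) *
        (edgeSetWeight q gb gw (Icc a m) (fun v => ∀ i, (i, v) ∉ E₁) E₁ r *
          edgeSetWeight q gb gw (Icc (m + 1) b) (fun v => ∃ w, (v, w) ∈ E₂) E₂ r) := by
  have l₁ := h₁.le
  have l₂ := h₂.le
  have hd : Disjoint E₁ E₂ := disjoint_left.2 fun e he he' => by
    have := h₁.bounds e he
    have := h₂.bounds e he'
    omega
  have hn : (a, b) ∉ E₁ ∪ E₂ := fun he => by
    rcases mem_union.1 he with he | he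
    · have := h₁.bounds _ he
      dsimp only at this
      omega
    · have := h₂.bounds _ he
      dsimp only at this
      omega
  have hI : Icc a b = Icc a m ∪ Icc (m + 1) b := by
    ext v
    simp only [mem_union, mem_Icc]
    omega
  have hId : Disjoint (Icc a m) (Icc (m + 1) b) := disjoint_left.2 fun v hv hv' => by
    rw [mem_Icc] at hv hv'
    omega
  have hB₁ : ∀ v ∈ Icc a m,
      ((∀ i, (i, v) ∉ insert (a, b) (E₁ ∪ E₂)) ↔ ∀ i, (i, v) ∉ E₁) := by
    intro v hv
    rw [mem_Icc] at hv
    refine forall_congr' fun i => not_congr ?_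
    simp only [mem_insert, mem_union, Prod.mk.injEq]
    constructor
    · rintro (h | h | h)
      · omega
      · exact h
      · have := h₂.bounds _ h
        dsimp only at this
        omega
    · exact fun h => Or.inr (Or.inl h)
  have hB₂ : ∀ v ∈ Icc (m + 1) b,
      ((∀ i, (i, v) ∉ insert (a, b) (E₁ ∪ E₂)) ↔ ∃ w, (v, w) ∈ E₂) := by
    intro v hv
    rw [mem_Icc] at hv
    rw [(h₁.join h₂).no_incoming_iff (by omega) (by omega) hv.2]
    refine exists_congr fun w => ?_
    simp only [mem_insert, mem_union, Prod.mk.injEq]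
    constructor
    · rintro (h | h | h)
      · omega
      · have := h₁.bounds _ h
        dsimp only at this
        omega
      · exact h
    · exact fun h => Or.inr (Or.inr h)
  have hP₁ := edgeSetWeight_congr q gb gw (E := ∅) (r := r) (by simp) hB₁ fun _ _ => rfl
  have hP₂ := edgeSetWeight_congr q gb gw (E := ∅) (r := r) (by simp) hB₂ fun _ _ => rfl
  simp only [edgeSetWeight, prod_empty, one_mul, neg_inj] at hP₁ hP₂
  unfold edgeSetWeight
  rw [prod_insert hn, prod_union hd, hI, prod_union hId, hP₁, hP₂]
  ring

end Weight

section TreeSum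

variable {ι : Type*} [Fintype ι] [AddCommMonoid ι]

/-- The sum of the weights of labelled trees on `[a, b]` with prescribed label at `a`. -/
noncomputable def leftTreeSum (q : ℕ → ι → ι → ℝ) (gb gw : ι → ℝ) (a b : ℕ) (x : ι) : ℝ :=
  ∑ E ∈ treesOn a b, ∑ r ∈ words ι (Icc a b),
    if r a = x then edgeSetWeight q gb gw (Icc a b) (fun v => ∀ i, (i, v) ∉ E) E r else 0

/-- The sum of the weights of labelled trees on `[a, b]` with prescribed label at `b`; for `a = b`
the vertex gets the second colour. -/
noncomputable def rightTreeSum (q : ℕ → ι → ι → ℝ) (gb gw : ι → ℝ) (a b : ℕ) (y : ι) : ℝ :=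
  ∑ E ∈ treesOn a b, ∑ r ∈ words ι (Icc a b),
    if r b = y then edgeSetWeight q gb gw (Icc a b) (fun v => ∃ m, (v, m) ∈ E) E r else 0

/-- The sum of the weights of labelled trees on `[a, b]` with prescribed labels at `a` and `b`. -/
noncomputable def pairTreeSum (q : ℕ → ι → ι → ℝ) (gb gw : ι → ℝ) (a b : ℕ) (x y : ι) : ℝ :=
  ∑ E ∈ treesOn a b, ∑ r ∈ words ι (Icc a b),
    if r a = x ∧ r b = y then
      edgeSetWeight q gb gw (Icc a b) (fun v => ∀ i, (i, v) ∉ E) E r else 0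

variable (q : ℕ → ι → ι → ℝ) (gb gw : ι → ℝ)

theorem leftTreeSum_eq_sum (a b : ℕ) (x : ι) :
    leftTreeSum q gb gw a b x = ∑ y, pairTreeSum q gb gw a b x y := by
  unfold leftTreeSum pairTreeSum
  rw [sum_comm (s := univ)]
  refine sum_congr rfl fun E _ => ?_
  rw [sum_comm (s := univ)]
  refine sum_congr rfl fun r _ => ?_
  by_cases h : r a = x <;> simp [h]

theorem rightTreeSum_eq_sum {a b : ℕ} (hab : a < b) (y : ι) :
    rightTreeSum q gb gw a b y = ∑ x, pairTreeSum q gb gw a b x y := by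
  unfold rightTreeSum pairTreeSum
  rw [sum_comm (s := univ)]
  refine sum_congr rfl fun E hE => ?_
  rw [sum_comm (s := univ)]
  refine sum_congr rfl fun r _ => ?_
  rw [mem_treesOn] at hE
  by_cases h : r b = y
  · simp only [h, and_true, sum_ite_eq, mem_univ, if_true]
    refine edgeSetWeight_congr q gb gw hE.edges_subset (fun v hv => ?_) fun _ _ => rfl
    rw [mem_Icc] at hv
    exact (hE.no_incoming_iff hab hv.1 hv.2).symm
  · simp [h]

theorem leftTreeSum_self (a : ℕ) (x : ι) : leftTreeSum q gb gw a a x = -gb x := by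
  have h := sum_words_singleton a fun z => if z = x then -gb z else 0
  rw [sum_ite_eq' univ x, if_pos (mem_univ x)] at h
  refine Eq.trans ?_ h
  simp [leftTreeSum, treesOn_self, edgeSetWeight]

theorem rightTreeSum_self (a : ℕ) (x : ι) : rightTreeSum q gb gw a a x = -gw x := by
  have h := sum_words_singleton a fun z => if z = x then -gw z else 0
  rw [sum_ite_eq' univ x, if_pos (mem_univ x)] at h
  refine Eq.trans ?_ h
  simp [rightTreeSum, treesOn_self, edgeSetWeight]

theorem pairTreeSum_of_lt {a b : ℕ} (hab : a < b) (x y : ι) :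
    pairTreeSum q gb gw a b x y = -q (b - a) x y *
      ∑ m ∈ Ico a b, leftTreeSum q gb gw a m x * rightTreeSum q gb gw (m + 1) b y := by
  unfold pairTreeSum
  rw [sum_treesOn hab, mul_sum]
  refine sum_congr rfl fun m hm => ?_
  rw [mem_Ico] at hm
  unfold leftTreeSum rightTreeSum
  rw [sum_mul_sum, mul_sum]
  refine sum_congr rfl fun E₁ hE₁ => ?_
  rw [mul_sum]
  refine sum_congr rfl fun E₂ hE₂ => ?_
  rw [mem_treesOn] at hE₁ hE₂
  have hI : Icc a b = Icc a m ∪ Icc (m + 1) b := by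
    ext v
    simp only [mem_union, mem_Icc]
    omega
  have hId : Disjoint (Icc a m) (Icc (m + 1) b) := disjoint_left.2 fun v hv hv' => by
    rw [mem_Icc] at hv hv'
    omega
  rw [← sum_words_union hId, ← hI, mul_sum]
  · refine sum_congr rfl fun r _ => ?_
    rw [edgeSetWeight_join q gb gw hE₁ hE₂]
    by_cases hx : r a = x
    · by_cases hy : r b = y
      · simp only [hx, hy, and_self, if_true]
      · simp [hy]
    · simp [hx]
  · intro r r' h
    rw [h a (left_mem_Icc.2 hE₁.le),
      edgeSetWeight_congr q gb gw hE₁.edges_subset (fun _ _ => Iff.rfl) h]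
  · intro r r' h
    rw [h b (right_mem_Icc.2 hE₂.le),
      edgeSetWeight_congr q gb gw hE₂.edges_subset (fun _ _ => Iff.rfl) h]

end TreeSum

theorem sum_leftTreeSum {ι : Type*} [Fintype ι] [AddCommMonoid ι] (q : ℕ → ι → ι → ℝ)
    (gb gw : ι → ℝ) (a b : ℕ) :
    ∑ x, leftTreeSum q gb gw a b x = ∑ E ∈ treesOn a b, ∑ r ∈ words ι (Icc a b),
      edgeSetWeight q gb gw (Icc a b) (fun v => ∀ i, (i, v) ∉ E) E r := by
  unfold leftTreeSum
  rw [sum_comm]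
  refine sum_congr rfl fun E _ => ?_
  rw [sum_comm]
  simp

/-- Edges between elements of `Fin n` as edges between natural numbers. -/
def finEdgeEmbedding (n : ℕ) : Fin n × Fin n ↪ ℕ × ℕ :=
  Fin.valEmbedding.prodMap Fin.valEmbedding

theorem mem_map_finEdgeEmbedding {n : ℕ} {E : Finset (Fin n × Fin n)} {e : ℕ × ℕ} :
    e ∈ E.map (finEdgeEmbedding n) ↔
      ∃ (h₁ : e.1 < n) (h₂ : e.2 < n), (⟨e.1, h₁⟩, ⟨e.2, h₂⟩) ∈ E := by
  rw [mem_map]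
  constructor
  · rintro ⟨⟨i, j⟩, h, rfl⟩
    exact ⟨i.2, j.2, h⟩
  · rintro ⟨h₁, h₂, h⟩
    exact ⟨_, h, rfl⟩

theorem coe_mem_map_finEdgeEmbedding {n : ℕ} {E : Finset (Fin n × Fin n)} {i j : Fin n} :
    ((i : ℕ), (j : ℕ)) ∈ E.map (finEdgeEmbedding n) ↔ (i, j) ∈ E := by
  rw [mem_map_finEdgeEmbedding]
  exact ⟨fun ⟨_, _, h⟩ => h, fun h => ⟨i.2, j.2, h⟩⟩

theorem isTreeOn_map_iff {n : ℕ} {E : Finset (Fin (n + 1) × Fin (n + 1))} :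
    IsTreeOn 0 n (E.map (finEdgeEmbedding (n + 1))) ↔ IsNCATree (n + 1) E := by
  constructor
  · intro h
    have hconn : ∀ v, EdgeReach (E.map (finEdgeEmbedding (n + 1))) 0 v → ∀ hv : v < n + 1,
        Relation.ReflTransGen (fun a b => (a, b) ∈ E ∨ (b, a) ∈ E) 0 ⟨v, hv⟩ := by
      intro v hr
      induction hr with
      | refl => exact fun _ => .refl
      | @tail x y _ hxy ih =>
        intro hy
        rcases hxy with hxy | hxy <;> obtain ⟨h₁, h₂, hm⟩ := mem_map_finEdgeEmbedding.1 hxy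
        · exact (ih h₁).tail (Or.inl hm)
        · exact (ih h₂).tail (Or.inr hm)
    refine ⟨fun e he => ?_, ?_, fun v w => ?_, fun e he e' he' => ?_, fun i v m hi hm => ?_⟩
    · exact (h.bounds _ (coe_mem_map_finEdgeEmbedding.2 he)).2.1
    · have := h.card
      rwa [card_map] at this
    · have : Std.Symm fun a b : Fin (n + 1) => (a, b) ∈ E ∨ (b, a) ∈ E := ⟨fun _ _ => Or.symm⟩
      exact (symm (hconn v (h.conn v (Nat.zero_le _) (by omega)) v.2)).trans
        (hconn w (h.conn w (Nat.zero_le _) (by omega)) w.2)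
    · exact h.nonCrossing _ (coe_mem_map_finEdgeEmbedding.2 he) _
        (coe_mem_map_finEdgeEmbedding.2 he')
    · exact h.alternating i v m (coe_mem_map_finEdgeEmbedding.2 hi)
        (coe_mem_map_finEdgeEmbedding.2 hm)
  · rintro ⟨hlt, hcard, hconn, hnc, halt⟩
    refine ⟨fun e he => ?_, ?_, fun v _ hv => ?_, fun e he e' he' => ?_, fun i v m hi hm => ?_⟩
    · obtain ⟨h₁, h₂, he⟩ := mem_map_finEdgeEmbedding.1 he
      exact ⟨Nat.zero_le _, hlt _ he, Nat.lt_succ_iff.1 h₂⟩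
    · rw [card_map, hcard]
      rfl
    · have key : ∀ w : Fin (n + 1),
          Relation.ReflTransGen (fun a b => (a, b) ∈ E ∨ (b, a) ∈ E) 0 w →
          EdgeReach (E.map (finEdgeEmbedding (n + 1))) 0 w := by
        intro w hr
        induction hr with
        | refl => exact .refl
        | tail _ hxy ih =>
          exact ih.tail (hxy.imp coe_mem_map_finEdgeEmbedding.2 coe_mem_map_finEdgeEmbedding.2)
      exact key ⟨v, Nat.lt_succ_iff.2 hv⟩ (hconn _ _)
    · obtain ⟨h₁, h₂, he⟩ := mem_map_finEdgeEmbedding.1 he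
      obtain ⟨h₁', h₂', he'⟩ := mem_map_finEdgeEmbedding.1 he'
      exact hnc _ he _ he'
    · obtain ⟨h₁, h₂, hi⟩ := mem_map_finEdgeEmbedding.1 hi
      obtain ⟨h₁', h₂', hm⟩ := mem_map_finEdgeEmbedding.1 hm
      exact halt _ _ _ hi hm

theorem sum_isNCATree (n : ℕ) (f : Finset (ℕ × ℕ) → ℝ) :
    ∑ E ∈ univ.filter (IsNCATree (n + 1)), f (E.map (finEdgeEmbedding (n + 1))) =
      ∑ E ∈ treesOn 0 n, f E := by
  refine sum_bij (fun E _ => E.map (finEdgeEmbedding (n + 1))) ?_ ?_ ?_ fun _ _ => rfl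
  · intro E hE
    exact mem_treesOn.2 (isTreeOn_map_iff.2 (mem_filter.1 hE).2)
  · exact fun E _ E' _ h => map_injective _ h
  · intro E hE
    have hE' := mem_treesOn.1 hE
    have h : (univ.filter fun e : Fin (n + 1) × Fin (n + 1) => ((e.1 : ℕ), (e.2 : ℕ)) ∈ E).map
        (finEdgeEmbedding (n + 1)) = E := by
      ext e
      rw [mem_map_finEdgeEmbedding]
      constructor
      · rintro ⟨h₁, h₂, h⟩
        exact (mem_filter.1 h).2
      · intro he
        have := hE'.bounds e he
        exact ⟨by omega, by omega, mem_filter.2 ⟨mem_univ _, he⟩⟩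
    refine ⟨_, ?_, h⟩
    rw [mem_filter, ← isTreeOn_map_iff, h]
    exact ⟨mem_univ _, hE'⟩

section TreeSeries

variable {L : ℕ} (X : Fin (L + 1) → ℝ) (Y : Fin L → ℝ) (u₀ : ℝ)

/-- The weight of an edge of length `d`. -/
noncomputable def edgeWeight (d : ℕ) (x y : Fin (L + 1)) : ℝ := 1 / (X y - X x + d)

/-- The signed weight of the label of a black vertex. -/
noncomputable def blackWeight (x : Fin (L + 1)) : ℝ :=
  if X x ≤ u₀ then -muWeight L X Y x else 0

/-- The weight of the label of a white vertex. -/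
noncomputable def whiteWeight (x : Fin (L + 1)) : ℝ :=
  if X x ≤ u₀ then 0 else muWeight L X Y x

theorem Kprime_succ (n : ℕ) :
    Kprime L X Y u₀ (n + 1) = n.factorial *
      ∑ x, leftTreeSum (edgeWeight X) (blackWeight X Y u₀) (whiteWeight X Y u₀) 0 n x := by
  rw [sum_leftTreeSum, Kprime, Nat.add_sub_cancel, ← sum_isNCATree]
  congr 1
  refine sum_congr rfl fun E hE => ?_
  obtain ⟨hlt, -⟩ := (mem_filter.1 hE).2
  have hI : Icc 0 n = range (n + 1) := by
    ext
    simp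
  rw [sum_filter, ← sum_words_range, hI]
  refine sum_congr rfl fun r _ => ?_
  have hB : ∀ v : Fin (n + 1),
      (∀ i, (i, (v : ℕ)) ∉ E.map (finEdgeEmbedding (n + 1))) ↔ v ∈ blackSet (n + 1) E := by
    intro v
    rw [blackSet, mem_filter]
    constructor
    · exact fun h => ⟨mem_univ _, fun i hi => h i (coe_mem_map_finEdgeEmbedding.2 hi)⟩
    · rintro ⟨-, h⟩ i hi
      obtain ⟨h₁, h₂, hm⟩ := mem_map_finEdgeEmbedding.1 hi
      exact h _ hm
  have hE : ∏ e ∈ E.map (finEdgeEmbedding (n + 1)), edgeWeight X (e.2 - e.1) (r e.1) (r e.2) =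
      ∏ e ∈ E, 1 / (X (r e.2) - X (r e.1) + (((e.2 : ℕ) : ℝ) - ((e.1 : ℕ) : ℝ))) := by
    rw [prod_map]
    refine prod_congr rfl fun e he => ?_
    rw [edgeWeight, ← Nat.cast_sub (hlt e he).le]
    rfl
  rw [edgeSetWeight, hE, prod_range]
  simp only [hB]
  split_ifs with h
  · have hv : ∀ v : Fin (n + 1), (if v ∈ blackSet (n + 1) E then blackWeight X Y u₀ (r v)
        else whiteWeight X Y u₀ (r v)) =
        (if v ∈ blackSet (n + 1) E then -1 else 1) * muWeight L X Y (r v) := by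
      intro v
      split_ifs with hv
      · rw [blackWeight, if_pos (h.1 v hv), neg_one_mul]
      · rw [whiteWeight, if_neg (h.2 v hv).not_ge, one_mul]
    have h0 : (0 : Fin (n + 1)) ∈ blackSet (n + 1) E :=
      mem_filter.2 ⟨mem_univ _, fun i hi => Nat.not_lt_zero _ (hlt _ hi)⟩
    obtain ⟨k, hk⟩ := Nat.exists_eq_succ_of_ne_zero (card_pos.2 ⟨_, h0⟩).ne'
    rw [prod_congr rfl fun v _ => hv v, prod_mul_distrib, prod_ite, prod_const_one, prod_const,
      filter_mem_eq_inter, univ_inter, hk, Nat.succ_sub_one, pow_succ]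
    ring
  · obtain ⟨v, hv⟩ : ∃ v : Fin (n + 1), (if v ∈ blackSet (n + 1) E then blackWeight X Y u₀ (r v)
        else whiteWeight X Y u₀ (r v)) = 0 := by
      by_contra! hc
      refine h ⟨fun v hv => ?_, fun v hv => ?_⟩
      · have := hc v
        rw [if_pos hv, blackWeight] at this
        by_contra hn
        exact this (if_neg hn)
      · have := hc v
        rw [if_neg hv, whiteWeight] at this
        by_contra hn
        exact this (if_pos (not_lt.1 hn))
    rw [prod_eq_zero (mem_univ v) hv, mul_zero, neg_zero]

variable {X}

theorem PowerSeries.coeff_one_X_mul_C (c : ℝ) :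
    PowerSeries.coeff 1 (PowerSeries.X * PowerSeries.C c) = c := by
  rw [← zero_add 1, PowerSeries.coeff_succ_X_mul, PowerSeries.coeff_zero_C]

theorem coeff_one_leftSeries (hX : Function.Injective X) (hgen : IsGeneric L X)
    (i : {i // X i ≤ u₀}) :
    PowerSeries.coeff 1 (leftSeries L X Y u₀ i) = muWeight L X Y i := by
  have := congrArg (PowerSeries.coeff 1) (sum_pairSeries_right Y u₀ hX hgen i)
  rw [map_sum, sum_eq_zero fun y _ => coeff_one_pairSeries Y u₀ y i, map_sub,
    PowerSeries.coeff_one_X_mul_C] at this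
  linarith

theorem coeff_one_rightSeries (y : Fin (L + 1)) :
    PowerSeries.coeff 1 (rightSeries L X Y u₀ y) = -muWeight L X Y y := by
  have := congrArg (PowerSeries.coeff 1) (sum_pairSeries_left (X := X) Y u₀ y)
  rw [map_sum, sum_eq_zero fun i _ => coeff_one_pairSeries Y u₀ y i, map_add,
    PowerSeries.coeff_one_X_mul_C] at this
  linarith

theorem treeSum_eq_coeff (hX : Function.Injective X) (hgen : IsGeneric L X) (n : ℕ) : ∀ a : ℕ,
    (∀ x, leftTreeSum (edgeWeight X) (blackWeight X Y u₀) (whiteWeight X Y u₀) a (a + n) x =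
      if h : X x ≤ u₀ then PowerSeries.coeff (n + 1) (leftSeries L X Y u₀ ⟨x, h⟩) else 0) ∧
    (∀ y, rightTreeSum (edgeWeight X) (blackWeight X Y u₀) (whiteWeight X Y u₀) a (a + n) y =
      if X y ≤ u₀ then 0 else PowerSeries.coeff (n + 1) (rightSeries L X Y u₀ y)) := by
  induction n using Nat.strong_induction_on with
  | _ n ih =>
  intro a
  rcases n.eq_zero_or_pos with rfl | hn
  · constructor
    · intro x
      rw [add_zero, leftTreeSum_self, blackWeight]
      split_ifs with h
      · rw [zero_add, coeff_one_leftSeries Y u₀ hX hgen, neg_neg]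
      · rw [neg_zero]
    · intro y
      rw [add_zero, rightTreeSum_self, whiteWeight]
      split_ifs with h
      · rw [neg_zero]
      · rw [zero_add, coeff_one_rightSeries]
  have hpair : ∀ x y, pairTreeSum (edgeWeight X) (blackWeight X Y u₀) (whiteWeight X Y u₀)
      a (a + n) x y = if h : X x ≤ u₀ then if X y ≤ u₀ then 0 else
        PowerSeries.coeff (n + 1) (pairSeries L X Y u₀ y ⟨x, h⟩) else 0 := by
    intro x y
    rw [pairTreeSum_of_lt _ _ _ (by omega), sum_Ico_eq_sum_range, Nat.add_sub_cancel_left]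
    have hk : ∀ k ∈ range n,
        leftTreeSum (edgeWeight X) (blackWeight X Y u₀) (whiteWeight X Y u₀) a (a + k) x *
          rightTreeSum (edgeWeight X) (blackWeight X Y u₀) (whiteWeight X Y u₀)
            (a + k + 1) (a + n) y =
        if h : X x ≤ u₀ then if X y ≤ u₀ then 0 else
          PowerSeries.coeff (k + 1) (leftSeries L X Y u₀ ⟨x, h⟩) *
            PowerSeries.coeff (n + 1 - (k + 1)) (rightSeries L X Y u₀ y) else 0 := by
      intro k hk
      rw [mem_range] at hk
      have e : a + n = a + k + 1 + (n - 1 - k) := by omega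
      have e' : n - 1 - k + 1 = n + 1 - (k + 1) := by omega
      rw [(ih k hk a).1, e, (ih (n - 1 - k) (by omega) _).2, e']
      split_ifs <;> simp
    rw [sum_congr rfl hk]
    split_ifs with hx hy
    · simp
    · have h := coeff_pairSeries Y u₀ hgen y ⟨x, hx⟩ (n + 1)
      rw [Nat.sum_antidiagonal_eq_sum_range_succ (fun i j =>
          PowerSeries.coeff i (leftSeries L X Y u₀ ⟨x, hx⟩) *
            PowerSeries.coeff j (rightSeries L X Y u₀ y)), sum_range_succ, sum_range_succ',
        coeff_zero_leftSeries, Nat.sub_self, coeff_zero_rightSeries, zero_mul, mul_zero, add_zero,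
        add_zero, Nat.cast_add, Nat.cast_one, add_sub_cancel_right] at h
      have hne := hgen.add_ne_zero y x hn.ne'
      rw [edgeWeight, neg_mul, ← mul_neg, ← h, ← mul_assoc,
        one_div_mul_cancel hne, one_mul]
    · simp
  constructor
  · intro x
    rw [leftTreeSum_eq_sum, sum_congr rfl fun y _ => hpair x y]
    split_ifs with hx
    · have h := congrArg (PowerSeries.coeff (n + 1)) (sum_pairSeries_right Y u₀ hX hgen ⟨x, hx⟩)
      rw [map_sum, map_sub, PowerSeries.coeff_succ_X_mul, PowerSeries.coeff_C, if_neg hn.ne',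
        sub_zero, sum_filter] at h
      rw [← h]
      refine sum_congr rfl fun y _ => ?_
      by_cases hy : X y ≤ u₀
      · rw [if_pos hy, if_neg hy.not_gt]
      · rw [if_neg hy, if_pos (not_le.1 hy)]
    · simp
  · intro y
    rw [rightTreeSum_eq_sum _ _ _ (by omega), sum_congr rfl fun x _ => hpair x y]
    split_ifs with hy
    · simp
    · have h := congrArg (PowerSeries.coeff (n + 1)) (sum_pairSeries_left (X := X) Y u₀ y)
      rw [map_sum, map_add, PowerSeries.coeff_succ_X_mul, PowerSeries.coeff_C, if_neg hn.ne',
        zero_add] at h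
      rw [← h, sum_dite, sum_const_zero, add_zero]
      exact sum_bij' (fun x _ => ⟨x, (mem_filter.1 x.2).2⟩)
        (fun x _ => ⟨x, mem_filter.2 ⟨mem_univ _, x.2⟩⟩) (by simp) (by simp) (by simp) (by simp)
        (by simp)

theorem Kprime_succ_eq_coeff (hX : Function.Injective X) (hgen : IsGeneric L X) (n : ℕ) :
    Kprime L X Y u₀ (n + 1) =
      n.factorial * ∑ i, PowerSeries.coeff (n + 1) (leftSeries L X Y u₀ i) := by
  have h := (treeSum_eq_coeff Y u₀ hX hgen n 0).1
  rw [zero_add] at h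
  rw [Kprime_succ, sum_congr rfl fun x _ => h x, sum_dite, sum_const_zero, add_zero]
  congr 1
  exact sum_bij' (fun x _ => ⟨x, (mem_filter.1 x.2).2⟩)
    (fun x _ => ⟨x, mem_filter.2 ⟨mem_univ _, x.2⟩⟩) (by simp) (by simp) (by simp) (by simp)
    (by simp)

theorem momentM_succ (hX : StrictMono X) (hgen : IsGeneric L X) (n : ℕ) :
    momentM L X Y u₀ (n + 1) = ∑ k ∈ range (n + 1),
      (n.choose k : ℝ) * (Kprime L X Y u₀ (k + 1) * momentM L X Y u₀ (n - k)) := by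
  have h := congrArg (PowerSeries.coeff (n + 1)) (eulerDerivation_det Y u₀ hgen)
  rw [coeff_eulerDerivation, mul_comm (Matrix.det _), PowerSeries.coeff_mul,
    Nat.sum_antidiagonal_eq_sum_range_succ (fun i j =>
      PowerSeries.coeff i (∑ i, leftSeries L X Y u₀ i) *
        PowerSeries.coeff j (1 + lowKernel L X Y u₀).det), sum_range_succ', map_sum,
    sum_eq_zero fun i _ => coeff_zero_leftSeries Y u₀ i, zero_mul, add_zero] at h
  rw [momentM_eq_coeff hX hgen, Nat.factorial_succ, Nat.cast_mul, mul_right_comm, h, sum_mul]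
  refine sum_congr rfl fun k hk => ?_
  rw [Kprime_succ_eq_coeff Y u₀ hX.injective hgen, momentM_eq_coeff hX hgen, map_sum,
    ← Nat.choose_mul_factorial_mul_factorial (Nat.lt_succ_iff.1 (mem_range.1 hk)),
    Nat.add_sub_add_right]
  push_cast
  ring

end TreeSeries

/-- The numbers `K'_j` are the formal cumulants of the moment sequence
`(M_n(Λ, u₀))`: the moments are obtained from them by the moment-cumulant
summation over set partitions. -/
theorem momentM_eq_sum_partitions_Kprime (L : ℕ) (X : Fin (L + 1) → ℝ)
    (Y : Fin L → ℝ) (hΛ : IsInterlacing L X Y) (hgen : IsGeneric L X) (u₀ : ℝ)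
    (n : ℕ) (hn : 1 ≤ n) :
    momentM L X Y u₀ n =
      ∑ π ∈ (univ : Finset (Finset (Finset (Fin n)))).filter (IsSetPartition n),
        ∏ b ∈ π, Kprime L X Y u₀ b.card := by
  have hX := hΛ.strictMono
  have h0 : momentM L X Y u₀ 0 = 1 := by
    rw [momentM_eq_coeff hX hgen, constantCoeff_det_one_add_lowKernel, Nat.factorial_zero,
      Nat.cast_one, one_mul]
  rw [filter_isSetPartition, sum_finsetPartitions_eq _ _ h0 (momentM_succ Y u₀ hX hgen),
    card_univ, Fintype.card_fin]
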